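/- For every positive integer q, the integral group homology of PSL_2(O_{-15}) with trivial ℤ-coefficients is given, as an abelian group, by: H_1 ≅ ℤ² ⊕ ℤ/3 ⊕ ℤ/2; H_2 ≅ ℤ ⊕ ℤ/3 ⊕ ℤ/2; and H_q ≅ ℤ/3 ⊕ ℤ/2 for all q ≥ 3. -/

import Mathlib

/-!
Group homology via the inhomogeneous bar complex (trivial coefficients).
-/

namespace BarHomology

/-- The `n`-th term of the inhomogeneous bar complex of `G` with trivial coefficients in `A`. -/
abbrev chains (G : Type) (A : Type) [AddCommGroup A] (n : ℕ) : Type := (Fin n → G) →₀ A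

/-- The differential of the inhomogeneous bar complex with trivial coefficients:
`d (g₁, …, g_{n+1}) = (g₂, …, g_{n+1}) + ∑_{j=1}^{n} (-1)^j (g₁, …, g_j g_{j+1}, …, g_{n+1})
  + (-1)^{n+1} (g₁, …, g_n)`. -/
noncomputable def d (k : Type) [CommRing k] (G : Type) [Group G] (A : Type) [AddCommGroup A]
    [Module k A] (n : ℕ) : chains G A (n + 1) →ₗ[k] chains G A n :=
  Finsupp.lsum k fun g =>
    (Finsupp.lsingle (fun i => g i.succ) : A →ₗ[k] chains G A n)
      + ∑ j : Fin (n + 1),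
          ((-1 : k) ^ ((j : ℕ) + 1)) • (Finsupp.lsingle (Fin.contractNth j (· * ·) g))

/-- The cycles: everything in degree `0`, the kernel of the differential in positive degrees. -/
noncomputable def cycles (k : Type) [CommRing k] (G : Type) [Group G] (A : Type) [AddCommGroup A]
    [Module k A] : (n : ℕ) → Submodule k (chains G A n)
  | 0 => ⊤
  | (n + 1) => LinearMap.ker (d k G A n)

/-- The boundaries, viewed as a submodule of the cycles. -/
noncomputable def boundariesIn (k : Type) [CommRing k] (G : Type) [Group G] (A : Type)
    [AddCommGroup A] [Module k A] (n : ℕ) : Submodule k (cycles k G A n) :=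
  (LinearMap.range (d k G A n)).comap (cycles k G A n).subtype

/-- Group homology of `G` in degree `n` with trivial coefficients in the `k`-module `A`,
defined as cycles modulo boundaries in the inhomogeneous bar complex. -/
abbrev GroupHomology (k : Type) [CommRing k] (G : Type) [Group G] (A : Type) [AddCommGroup A]
    [Module k A] (n : ℕ) : Type :=
  ↥(cycles k G A n) ⧸ boundariesIn k G A n

section Maps

variable {k : Type} [CommRing k] {G G' : Type} [Group G] [Group G'] {A : Type} [AddCommGroup A]
  [Module k A]

/-- The chain map induced by a group homomorphism. -/
noncomputable def chainsMap (k : Type) [CommRing k] (A : Type) [AddCommGroup A] [Module k A]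
    (φ : G →* G') (n : ℕ) : chains G A n →ₗ[k] chains G' A n :=
  Finsupp.lmapDomain A k (fun f => φ ∘ f)

lemma comp_contractNth (φ : G →* G') {n : ℕ} (j : Fin (n + 1)) (g : Fin (n + 1) → G) :
    φ ∘ Fin.contractNth j (· * ·) g = Fin.contractNth j (· * ·) (φ ∘ g) := by
  funext i
  rcases lt_trichotomy (i : ℕ) (j : ℕ) with h | h | h
  · simp [Function.comp_apply, Fin.contractNth_apply_of_lt _ _ _ _ h]
  · simp [Function.comp_apply, Fin.contractNth_apply_of_eq _ _ _ _ h, map_mul]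
  · simp [Function.comp_apply, Fin.contractNth_apply_of_gt _ _ _ _ h]

lemma chainsMap_comm (φ : G →* G') (n : ℕ) :
    (d k G' A n).comp (chainsMap k A φ (n + 1))
      = (chainsMap k A φ n).comp (d k G A n) := by
  apply Finsupp.lhom_ext
  intro g a
  simp only [LinearMap.comp_apply, chainsMap, Finsupp.lmapDomain_apply, Finsupp.mapDomain_single,
    d, Finsupp.lsum_single, LinearMap.add_apply, LinearMap.sum_apply, LinearMap.smul_apply,
    Finsupp.lsingle_apply, map_add, map_sum, map_smul]
  congr 1
  refine Finset.sum_congr rfl fun j _ => ?_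
  rw [comp_contractNth]

lemma chainsMap_mem_cycles (φ : G →* G') {n : ℕ} {x : chains G A n}
    (hx : x ∈ cycles k G A n) : chainsMap k A φ n x ∈ cycles k G' A n := by
  cases n with
  | zero => trivial
  | succ n =>
    simp only [cycles, LinearMap.mem_ker] at hx ⊢
    have := LinearMap.congr_fun (chainsMap_comm (k := k) (A := A) φ n) x
    simp only [LinearMap.comp_apply] at this
    rw [this, hx, map_zero]

/-- The map induced by a group homomorphism on cycles. -/
noncomputable def cyclesMap (k : Type) [CommRing k] (A : Type) [AddCommGroup A] [Module k A]
    (φ : G →* G') (n : ℕ) : ↥(cycles k G A n) →ₗ[k] ↥(cycles k G' A n) :=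
  (chainsMap k A φ n).restrict fun _ hx => chainsMap_mem_cycles φ hx

/-- The map induced by a group homomorphism on group homology with trivial coefficients. -/
noncomputable def inducedMap (k : Type) [CommRing k] (A : Type) [AddCommGroup A] [Module k A]
    (φ : G →* G') (n : ℕ) :
    GroupHomology k G A n →ₗ[k] GroupHomology k G' A n :=
  Submodule.mapQ (boundariesIn k G A n) (boundariesIn k G' A n) (cyclesMap k A φ n) (by
    rintro ⟨x, hx⟩ hb
    simp only [boundariesIn, Submodule.mem_comap, Submodule.subtype_apply,
      LinearMap.mem_range] at hb ⊢
    obtain ⟨w, hw⟩ := hb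
    refine ⟨chainsMap k A φ (n + 1) w, ?_⟩
    have := LinearMap.congr_fun (chainsMap_comm (k := k) (A := A) φ n) w
    simp only [LinearMap.comp_apply] at this
    rw [this, hw]
    rfl)

end Maps

end BarHomology

open BarHomology

/-- The projective special linear group `PSL₂(R)`, i.e. `SL₂(R)` modulo its center. -/
abbrev PSL2 (R : Type) [CommRing R] : Type :=
  Matrix.ProjectiveSpecialLinearGroup (Fin 2) R

open CategoryTheory

/-- The homology at the middle of a pair of composable linear maps. -/
abbrev MiddleHomology {k X Y Z : Type*} [CommRing k] [AddCommGroup X] [AddCommGroup Y]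
    [AddCommGroup Z] [Module k X] [Module k Y] [Module k Z] (f : X →ₗ[k] Y) (g : Y →ₗ[k] Z) :
    Type _ :=
  LinearMap.ker g ⧸ (LinearMap.range f).comap (LinearMap.ker g).subtype

/-- Two linear maps composing to zero, as a short complex. -/
noncomputable abbrev linearShortComplex {k X Y Z : Type} [CommRing k] [AddCommGroup X]
    [AddCommGroup Y] [AddCommGroup Z] [Module k X] [Module k Y] [Module k Z] (f : X →ₗ[k] Y)
    (g : Y →ₗ[k] Z) (h : g ∘ₗ f = 0) : ShortComplex (ModuleCat k) :=
  ShortComplex.mk (ModuleCat.ofHom f) (ModuleCat.ofHom g) (by rw [← ModuleCat.ofHom_comp, h]; rfl)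

theorem nonempty_homology_addEquiv_middleHomology {k X Y Z : Type} [CommRing k] [AddCommGroup X]
    [AddCommGroup Y] [AddCommGroup Z] [Module k X] [Module k Y] [Module k Z] (f : X →ₗ[k] Y)
    (g : Y →ₗ[k] Z) (h : g ∘ₗ f = 0) :
    Nonempty ((linearShortComplex f g h).homology ≃+ MiddleHomology f g) := by
  have e := (linearShortComplex f g h).moduleCatHomologyIso.toLinearEquiv.toAddEquiv
  refine ⟨e.trans ?_⟩
  refine (Submodule.quotEquivOfEq _ _ ?_).toAddEquiv
  ext ⟨x, hx⟩
  constructor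
  · rintro ⟨y, hy⟩
    exact ⟨y, congrArg Subtype.val hy⟩
  · rintro ⟨y, hy⟩
    exact ⟨y, Subtype.ext hy⟩

theorem nonempty_complex_homology_addEquiv {k X Y Z : Type} [CommRing k] [AddCommGroup X]
    [AddCommGroup Y] [AddCommGroup Z] [Module k X] [Module k Y] [Module k Z]
    (C : ChainComplex (ModuleCat.{0} k) ℕ) (n : ℕ) (f : X →ₗ[k] Y)
    (g : Y →ₗ[k] Z) (h : g ∘ₗ f = 0) (e₁ : C.X (n + 2) ≃ₗ[k] X) (e₂ : C.X (n + 1) ≃ₗ[k] Y)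
    (e₃ : C.X n ≃ₗ[k] Z) (hf : ∀ x, e₂ ((C.d (n + 2) (n + 1)).hom x) = f (e₁ x))
    (hg : ∀ x, e₃ ((C.d (n + 1) n).hom x) = g (e₂ x)) :
    Nonempty (C.homology (n + 1) ≃+ MiddleHomology f g) := by
  obtain ⟨e⟩ := nonempty_homology_addEquiv_middleHomology f g h
  have i₁ := C.homologyIsoSc' (n + 2) (n + 1) n (by simp) (by simp)
  have i₂ : C.sc' (n + 2) (n + 1) n ≅ linearShortComplex f g h :=
    ShortComplex.isoMk e₁.toModuleIso e₂.toModuleIso e₃.toModuleIso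
      (by ext x; exact (hf x).symm) (by ext x; exact (hg x).symm)
  exact ⟨((i₁ ≪≫ ShortComplex.homologyMapIso i₂).toLinearEquiv.toAddEquiv).trans e⟩

theorem inhomogeneousChains_d_trivial (G : Type) [Group G] (n : ℕ) :
    (groupHomology.inhomogeneousChains.d (Rep.trivial ℤ G ℤ) n).hom = BarHomology.d ℤ G ℤ n := by
  rfl

theorem nonempty_groupHomology_addEquiv (G : Type) [Group G] (n : ℕ) :
    Nonempty (groupHomology (Rep.trivial ℤ G ℤ) (n + 1) ≃+ GroupHomology ℤ G ℤ (n + 1)) := by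
  have hd : ∀ (m : ℕ) (x : (Fin (m + 1) → G) →₀ ℤ),
      ((groupHomology.inhomogeneousChains (Rep.trivial ℤ G ℤ)).d (m + 1) m).hom x =
        BarHomology.d ℤ G ℤ m x := by
    intro m x
    rw [groupHomology.inhomogeneousChains.d_def, inhomogeneousChains_d_trivial]
  have hdd : BarHomology.d ℤ G ℤ n ∘ₗ BarHomology.d ℤ G ℤ (n + 1) = 0 := by
    rw [← inhomogeneousChains_d_trivial, ← inhomogeneousChains_d_trivial, ← ModuleCat.hom_comp,
      groupHomology.inhomogeneousChains.d_comp_d]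
    rfl
  exact nonempty_complex_homology_addEquiv
    (groupHomology.inhomogeneousChains (Rep.trivial ℤ G ℤ)) n (BarHomology.d ℤ G ℤ (n + 1))
    (BarHomology.d ℤ G ℤ n) hdd (LinearEquiv.refl _ _) (LinearEquiv.refl _ _)
    (LinearEquiv.refl _ _) (hd (n + 1)) (hd n)

/-- The augmentation of the integral group ring. -/
noncomputable def augmentation (G : Type) [Group G] : MonoidAlgebra ℤ G →ₐ[ℤ] ℤ :=
  MonoidAlgebra.lift ℤ ℤ G 1

@[simp]
theorem augmentation_single {G : Type} [Group G] (g : G) (r : ℤ) :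
    augmentation G (.single g r) = r := by
  simp [augmentation]

/-- The coordinatewise augmentation of a free module over the group ring. -/
noncomputable def finsuppAugmentation (G ι : Type) [Group G] :
    (ι →₀ MonoidAlgebra ℤ G) →ₗ[ℤ] (ι →₀ ℤ) :=
  Finsupp.mapRange.linearMap (augmentation G).toLinearMap

theorem finsuppAugmentation_single {G ι : Type} [Group G] (i : ι) (x : MonoidAlgebra ℤ G) :
    finsuppAugmentation G ι (.single i x) = .single i (augmentation G x) := by
  simp [finsuppAugmentation]

theorem free_apply_eq_smul {G ι : Type} [Group G] (g : G) (x : ι →₀ MonoidAlgebra ℤ G) :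
    Representation.free ℤ G ι g x = (MonoidAlgebra.single g (1 : ℤ)) • x := by
  induction x using Finsupp.induction_linear with
  | zero => simp
  | add x y hx hy => rw [map_add, hx, hy, smul_add]
  | single i r =>
    induction r using MonoidAlgebra.induction_linear with
    | zero => simp
    | add r s hr hs => rw [Finsupp.single_add, map_add, hr, hs, smul_add]
    | single h s => simp [MonoidAlgebra.single_mul_single]

/-- A linear map between free modules over the group ring, as a morphism of representations. -/
noncomputable def freeHom {G ι κ : Type} [Group G]
    (f : (ι →₀ MonoidAlgebra ℤ G) →ₗ[MonoidAlgebra ℤ G] (κ →₀ MonoidAlgebra ℤ G)) :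
    Rep.free ℤ G ι ⟶ Rep.free ℤ G κ :=
  Rep.ofHom ((f.restrictScalars ℤ).intertwiningMap_of_isIntertwiningMap _ _ fun g v => by
    simp only [LinearMap.coe_restrictScalars]
    rw [free_apply_eq_smul, free_apply_eq_smul, map_smul])

theorem rep_exact_of_forall {k G : Type} [CommRing k] [Group G]
    (S : ShortComplex (Rep.{0} k G))
    (h : ∀ x : S.X₂, S.g.hom x = 0 → ∃ y : S.X₁, S.f.hom y = x) : S.Exact := by
  apply (forget₂ (Rep.{0} k G) (ModuleCat k)).reflects_exact_of_faithful
  rw [ShortComplex.moduleCat_exact_iff]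
  exact h

section Resolution

variable {G : Type} [Group G] {ι : ℕ → Type}
  (f : ∀ n, (ι (n + 1) →₀ MonoidAlgebra ℤ G) →ₗ[MonoidAlgebra ℤ G] (ι n →₀ MonoidAlgebra ℤ G))
  (hf : ∀ n, Function.Exact (f (n + 1)) (f n))
  (ε : (ι 0 →₀ MonoidAlgebra ℤ G) →ₗ[ℤ] ℤ)
  (hε : ∀ (g : G) (x : ι 0 →₀ MonoidAlgebra ℤ G), ε (MonoidAlgebra.single g (1 : ℤ) • x) = ε x)
  (hf₀ : Function.Exact (f 0) ε)

/-- The chain complex of representations attached to a sequence of linear maps between free modules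
over the group ring. -/
noncomputable def freeComplex : ChainComplex (Rep ℤ G) ℕ :=
  ChainComplex.of (fun n => Rep.free ℤ G (ι n)) (fun n => freeHom (f n)) fun n => by
    refine Rep.hom_ext (Representation.IntertwiningMap.ext (LinearMap.ext fun x => ?_))
    exact (hf n _).2 ⟨x, rfl⟩

theorem freeComplex_d (n : ℕ) : (freeComplex f hf).d (n + 1) n = freeHom (f n) :=
  ChainComplex.of_d (fun n => Rep.free ℤ G (ι n)) (fun n => freeHom (f n)) n

/-- An invariant functional as a morphism of representations. -/
noncomputable def freeAugmentationHom : Rep.free ℤ G (ι 0) ⟶ Rep.trivial ℤ G ℤ :=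
  Rep.ofHom (ε.intertwiningMap_of_isIntertwiningMap _ _ fun g v => by
    rw [free_apply_eq_smul, hε]; rfl)

/-- The augmentation of the complex `freeComplex`. -/
noncomputable def freeComplexπ :
    freeComplex f hf ⟶ (ChainComplex.single₀ (Rep ℤ G)).obj (Rep.trivial ℤ G ℤ) :=
  ((freeComplex f hf).toSingle₀Equiv _).symm ⟨freeAugmentationHom ε hε, by
    rw [freeComplex_d]
    refine Rep.hom_ext (Representation.IntertwiningMap.ext (LinearMap.ext fun x => ?_))
    exact (hf₀ _).2 ⟨x, rfl⟩⟩

theorem freeComplexπ_quasiIso (hε_surj : Function.Surjective ε) :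
    QuasiIso (freeComplexπ f hf ε hε hf₀) where
  quasiIsoAt m := by
    cases m with
    | zero =>
      have hπ : (freeComplexπ f hf ε hε hf₀).f 0 = freeAugmentationHom ε hε := by
        simp [freeComplexπ, ChainComplex.toSingle₀Equiv]
        rfl
      rw [ChainComplex.quasiIsoAt₀_iff, ShortComplex.quasiIso_iff_of_zeros' _ rfl rfl rfl]
      constructor
      · refine rep_exact_of_forall _ fun x hx => ?_
        have hx' : ((freeComplexπ f hf ε hε hf₀).f 0).hom x = 0 := hx
        rw [hπ] at hx'
        obtain ⟨y, hy⟩ := (hf₀ x).1 hx'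
        refine ⟨y, Eq.trans ?_ hy⟩
        change ((freeComplex f hf).d (0 + 1) 0).hom y = _
        rw [freeComplex_d]
        rfl
      · rw [Rep.epi_iff_surjective]
        intro x
        obtain ⟨y, hy⟩ := hε_surj x
        refine ⟨y, Eq.trans ?_ hy⟩
        change ((freeComplexπ f hf ε hε hf₀).f 0).hom y = _
        rw [hπ]
        rfl
    | succ m =>
      rw [quasiIsoAt_iff_exactAt' (hL := ChainComplex.exactAt_succ_single_obj ..),
          HomologicalComplex.exactAt_iff' _ (m + 2) (m + 1) m (by simp) (by simp)]
      refine rep_exact_of_forall _ fun x hx => ?_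
      have hx' : ((freeComplex f hf).d (m + 1) m).hom x = 0 := hx
      rw [freeComplex_d] at hx'
      obtain ⟨y, hy⟩ := (hf m x).1 hx'
      refine ⟨y, Eq.trans ?_ hy⟩
      change ((freeComplex f hf).d (m + 1 + 1) (m + 1)).hom y = _
      rw [freeComplex_d]
      rfl

/-- An exact augmented sequence of free modules over the group ring, as a projective resolution of
the trivial representation. -/
noncomputable def freeResolution (hε_surj : Function.Surjective ε) :
    ProjectiveResolution (Rep.trivial ℤ G ℤ) where
  complex := freeComplex f hf
  projective n := inferInstanceAs (Projective (Rep.free ℤ G (ι n)))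
  π := freeComplexπ f hf ε hε hf₀
  quasiIso := freeComplexπ_quasiIso f hf ε hε hf₀ hε_surj

open scoped TensorProduct in
theorem coinvariantsTensorFreeLEquiv_mk {κ : Type} [DecidableEq κ] (r : ℤ)
    (v : κ →₀ MonoidAlgebra ℤ G) :
    Rep.coinvariantsTensorFreeToFinsupp (Rep.trivial ℤ G ℤ) κ
      (Representation.Coinvariants.mk _ (r ⊗ₜ[ℤ] v)) = r • finsuppAugmentation G κ v := by
  induction v using Finsupp.induction_linear with
  | zero => rw [TensorProduct.tmul_zero, map_zero, map_zero, map_zero, smul_zero]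
  | add x y hx hy => rw [TensorProduct.tmul_add, map_add, map_add, map_add, smul_add, ← hx, ← hy]
  | single i x =>
    induction x using MonoidAlgebra.induction_linear with
    | zero => rw [Finsupp.single_zero, TensorProduct.tmul_zero, map_zero, map_zero, map_zero,
        smul_zero]
    | add x y hx hy =>
      rw [Finsupp.single_add, TensorProduct.tmul_add, map_add, map_add, map_add, smul_add, ← hx,
        ← hy]
    | single g s =>
      refine (Rep.coinvariantsTensorFreeToFinsupp_mk_tmul_single (Rep.trivial ℤ G ℤ) r i g s).trans
        ?_
      rw [finsuppAugmentation_single, augmentation_single]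
      simp [mul_comm]

theorem coinvariantsTensorFreeToFinsupp_map {κ μ : Type} [DecidableEq κ] [DecidableEq μ]
    (φ : (κ →₀ MonoidAlgebra ℤ G) →ₗ[MonoidAlgebra ℤ G] (μ →₀ MonoidAlgebra ℤ G))
    (Φ : (κ →₀ ℤ) →ₗ[ℤ] (μ →₀ ℤ))
    (h : ∀ x, Φ (finsuppAugmentation G _ x) = finsuppAugmentation G _ (φ x))
    (x : (((Rep.coinvariantsTensor ℤ G).obj (Rep.trivial ℤ G ℤ)).obj (Rep.free ℤ G κ))) :
    Rep.coinvariantsTensorFreeToFinsupp (Rep.trivial ℤ G ℤ) μ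
      ((((Rep.coinvariantsTensor ℤ G).obj (Rep.trivial ℤ G ℤ)).map (freeHom φ)).hom x) =
    Φ (Rep.coinvariantsTensorFreeToFinsupp (Rep.trivial ℤ G ℤ) κ x) := by
  have key : Rep.coinvariantsTensorFreeToFinsupp (Rep.trivial ℤ G ℤ) μ ∘ₗ
      (((Rep.coinvariantsTensor ℤ G).obj (Rep.trivial ℤ G ℤ)).map (freeHom φ)).hom =
      Φ ∘ₗ Rep.coinvariantsTensorFreeToFinsupp (Rep.trivial ℤ G ℤ) κ := by
    refine Representation.Coinvariants.hom_ext
      (TensorProduct.ext' fun (r : ℤ) (v : κ →₀ MonoidAlgebra ℤ G) => ?_)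
    have h₁ := congrArg Φ (coinvariantsTensorFreeLEquiv_mk (G := G) r v)
    have h₂ := coinvariantsTensorFreeLEquiv_mk (G := G) r (φ v)
    exact h₂.trans (((congrArg (r • ·) (h v)).symm.trans (map_smul Φ r _).symm).trans h₁.symm)
  exact LinearMap.congr_fun key x

theorem nonempty_groupHomology_addEquiv_of_resolution
    (hf : ∀ n, Function.Exact (f (n + 1)) (f n)) (ε : (ι 0 →₀ MonoidAlgebra ℤ G) →ₗ[ℤ] ℤ)
    (hε : ∀ (g : G) (x : ι 0 →₀ MonoidAlgebra ℤ G), ε (MonoidAlgebra.single g (1 : ℤ) • x) = ε x)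
    (hf₀ : Function.Exact (f 0) ε) (hε_surj : Function.Surjective ε)
    (F : ∀ n, (ι (n + 1) →₀ ℤ) →ₗ[ℤ] (ι n →₀ ℤ))
    (hF : ∀ n x, F n (finsuppAugmentation G _ x) = finsuppAugmentation G _ (f n x)) (n : ℕ) :
    Nonempty (GroupHomology ℤ G ℤ (n + 1) ≃+ MiddleHomology (F (n + 1)) (F n)) := by
  classical
  obtain ⟨e₁⟩ := nonempty_groupHomology_addEquiv G n
  have e₂ := (groupHomologyIso (Rep.trivial ℤ G ℤ) (n + 1)
    (freeResolution f hf ε hε hf₀ hε_surj)).toLinearEquiv.toAddEquiv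
  have hFF : F n ∘ₗ F (n + 1) = 0 := by
    ext1 i
    ext1
    have h := hF n (f (n + 1) (.single i (.single 1 1)))
    rw [(hf n _).2 ⟨_, rfl⟩, map_zero, ← hF, finsuppAugmentation_single, augmentation_single] at h
    exact h
  have hd : ∀ (m : ℕ) (x : (((freeComplex f hf).coinvariantsTensorObj
      (Rep.trivial ℤ G ℤ)).X (m + 1))),
      Rep.coinvariantsTensorFreeLEquiv (Rep.trivial ℤ G ℤ) (ι m)
        ((((freeComplex f hf).coinvariantsTensorObj (Rep.trivial ℤ G ℤ)).d (m + 1) m).hom x) =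
      F m (Rep.coinvariantsTensorFreeLEquiv (Rep.trivial ℤ G ℤ) (ι (m + 1)) x) := by
    intro m x
    have h : (((freeComplex f hf).coinvariantsTensorObj (Rep.trivial ℤ G ℤ)).d (m + 1) m) =
        ((Rep.coinvariantsTensor ℤ G).obj (Rep.trivial ℤ G ℤ)).map (freeHom (f m)) :=
      congrArg (fun φ : Rep.free ℤ G (ι (m + 1)) ⟶ Rep.free ℤ G (ι m) =>
        ((Rep.coinvariantsTensor ℤ G).obj (Rep.trivial ℤ G ℤ)).map φ) (freeComplex_d f hf m)
    rw [h]
    exact coinvariantsTensorFreeToFinsupp_map (f m) (F m) (hF m) x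
  obtain ⟨e₃⟩ := nonempty_complex_homology_addEquiv
    ((freeComplex f hf).coinvariantsTensorObj (Rep.trivial ℤ G ℤ)) n (F (n + 1)) (F n) hFF
    (Rep.coinvariantsTensorFreeLEquiv (Rep.trivial ℤ G ℤ) _)
    (Rep.coinvariantsTensorFreeLEquiv (Rep.trivial ℤ G ℤ) _)
    (Rep.coinvariantsTensorFreeLEquiv (Rep.trivial ℤ G ℤ) _) (hd (n + 1)) (hd n)
  exact ⟨(e₁.symm.trans e₂).trans e₃⟩

end Resolution

section GroupRing

variable {G : Type}

/-- The pairing of the group ring with a function on the group. -/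
noncomputable def pairing (Φ : G → ℤ) : MonoidAlgebra ℤ G →+ ℤ where
  toFun x := x.coeff.sum fun g r => r * Φ g
  map_zero' := by simp
  map_add' x y := by
    rw [MonoidAlgebra.coeff_add, Finsupp.sum_add_index'] <;> simp [add_mul]

@[simp]
theorem pairing_single (Φ : G → ℤ) (g : G) (r : ℤ) :
    pairing Φ (MonoidAlgebra.single g r) = r * Φ g := by
  change (MonoidAlgebra.single g r).coeff.sum (fun g r => r * Φ g) = r * Φ g
  simp

theorem pairing_sub (Φ Ψ : G → ℤ) (x : MonoidAlgebra ℤ G) :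
    pairing (fun g => Φ g - Ψ g) x = pairing Φ x - pairing Ψ x := by
  induction x using MonoidAlgebra.induction_linear with
  | zero => simp
  | add x y hx hy => rw [map_add, map_add, map_add, hx, hy]; ring
  | single g r => simp [mul_sub]

theorem coeff_eq_pairing [DecidableEq G] (x : MonoidAlgebra ℤ G) (h : G) :
    x.coeff h = pairing (fun g => if g = h then 1 else 0) x := by
  induction x using MonoidAlgebra.induction_linear with
  | zero => simp
  | add x y hx hy => rw [map_add, ← hx, ← hy]; simp
  | single g r => simp [Finsupp.single_apply]

theorem pairing_finset_sum {κ : Type*} (T : Finset κ) (Φ : κ → G → ℤ) (x : MonoidAlgebra ℤ G) :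
    pairing (fun g => ∑ i ∈ T, Φ i g) x = ∑ i ∈ T, pairing (Φ i) x := by
  induction x using MonoidAlgebra.induction_linear with
  | zero => simp
  | add x y hx hy => simp only [map_add, hx, hy, Finset.sum_add_distrib]
  | single g r => simp [Finset.mul_sum]

variable [Group G]

theorem pairing_mul_of (Φ : G → ℤ) (x : MonoidAlgebra ℤ G) (s : G) :
    pairing Φ (x * MonoidAlgebra.of ℤ G s) = pairing (fun g => Φ (g * s)) x := by
  induction x using MonoidAlgebra.induction_linear with
  | zero => simp
  | add x y hx hy => rw [add_mul, map_add, map_add, hx, hy]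
  | single g r => simp [MonoidAlgebra.single_mul_single]

theorem pairing_mul_of_sub_one (Φ : G → ℤ) (x : MonoidAlgebra ℤ G) (s : G) :
    pairing Φ (x * (MonoidAlgebra.of ℤ G s - 1)) = pairing (fun g => Φ (g * s) - Φ g) x := by
  rw [mul_sub, mul_one, map_sub, pairing_mul_of, pairing_sub]

theorem pairing_mul_of_sub_one_eq_zero {Φ : G → ℤ} {s : G} (h : ∀ g, Φ (g * s) = Φ g)
    (x : MonoidAlgebra ℤ G) : pairing Φ (x * (MonoidAlgebra.of ℤ G s - 1)) = 0 := by
  rw [pairing_mul_of_sub_one]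
  simp [h, pairing]

theorem pairing_of_mul (Φ : G → ℤ) (x : MonoidAlgebra ℤ G) (h : G) :
    pairing Φ (MonoidAlgebra.of ℤ G h * x) = pairing (fun g => Φ (h * g)) x := by
  induction x using MonoidAlgebra.induction_linear with
  | zero => simp
  | add x y hx hy => rw [mul_add, map_add, map_add, hx, hy]
  | single g r => simp [MonoidAlgebra.single_mul_single]

theorem eq_zero_of_pairing [DecidableEq G] {x : MonoidAlgebra ℤ G}
    (h : ∀ k, pairing (fun g => if g = 1 then 1 else 0) (MonoidAlgebra.of ℤ G k * x) = 0) :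
    x = 0 := by
  ext g
  have := h g⁻¹
  rw [pairing_of_mul] at this
  rw [coeff_eq_pairing]
  simpa [inv_mul_eq_one, eq_comm] using this

open Classical in
theorem mem_of_coset_sums_eq_zero {P : Subgroup G} {S : Set G} (hS : P ≤ Subgroup.closure S)
    {I : Submodule (MonoidAlgebra ℤ G) (MonoidAlgebra ℤ G)}
    (hI : ∀ s ∈ S, MonoidAlgebra.of ℤ G s - 1 ∈ I) {x : MonoidAlgebra ℤ G}
    (hx : ∀ k, pairing (fun g => if g ∈ P then 1 else 0) (MonoidAlgebra.of ℤ G k * x) = 0) :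
    x ∈ I := by
  have hP : ∀ g ∈ P, MonoidAlgebra.of ℤ G g - 1 ∈ I := by
    intro g hg
    replace hg := hS hg
    induction hg using Subgroup.closure_induction with
    | mem s hs => exact hI s hs
    | one => rw [map_one, sub_self]; exact I.zero_mem
    | mul g h _ _ hg hh =>
      have := I.add_mem (I.smul_mem (MonoidAlgebra.of ℤ G g) hh) hg
      rwa [smul_eq_mul, mul_sub, mul_one, ← map_mul, sub_add_sub_cancel] at this
    | inv g _ hg =>
      have := I.neg_mem (I.smul_mem (MonoidAlgebra.of ℤ G g⁻¹) hg)
      rwa [smul_eq_mul, mul_sub, mul_one, ← map_mul, inv_mul_cancel, map_one, neg_sub] at this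
  let ρ : G → G := fun g => Quotient.out (QuotientGroup.mk (s := P) g)
  have hρ : ∀ g, (ρ g)⁻¹ * g ∈ P := fun g => QuotientGroup.eq.1 (Quotient.out_eq _)
  let y : MonoidAlgebra ℤ G → MonoidAlgebra ℤ G := fun x =>
    x.coeff.sum fun g r => MonoidAlgebra.single (ρ g) r
  have hy_add : ∀ x x', y (x + x') = y x + y x' := by
    intro x x'
    simp only [y]
    rw [MonoidAlgebra.coeff_add, Finsupp.sum_add_index'] <;> simp
  have hxy : ∀ x, x - y x ∈ I := by
    intro x
    induction x using MonoidAlgebra.induction_linear with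
    | zero => simp [y]
    | add x x' hx hx' =>
      rw [hy_add, add_sub_add_comm]
      exact I.add_mem hx hx'
    | single g r =>
      have h := I.smul_mem (MonoidAlgebra.single (ρ g) r) (hP _ (hρ g))
      have h' : y (MonoidAlgebra.single g r) = MonoidAlgebra.single (ρ g) r := by simp [y]
      rw [h']
      simpa [mul_sub, MonoidAlgebra.single_mul_single] using h
  have hyx : y x = 0 := by
    ext k
    have hc : ∀ x, (y x).coeff k = pairing (fun g => if ρ g = k then 1 else 0) x := by
      intro x
      induction x using MonoidAlgebra.induction_linear with
      | zero => simp [y]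
      | add x x' hx hx' => rw [hy_add, map_add, ← hx, ← hx']; simp
      | single g r => simp [y, Finsupp.single_apply]
    rw [hc]
    by_cases hk : ρ k = k
    · have := hx k⁻¹
      rw [pairing_of_mul] at this
      rw [MonoidAlgebra.coeff_zero, Finsupp.zero_apply]
      refine Eq.trans ?_ this
      congr 2
      ext g
      refine if_congr ?_ rfl rfl
      constructor
      · rintro rfl
        exact hρ g
      · intro h
        rw [← hk]
        simp only [ρ]
        rw [QuotientGroup.eq.2 h]
    · have : ∀ g, ρ g ≠ k := by
        rintro g rfl
        exact hk (by simp [ρ])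
      simp [this, pairing]
  have := hxy x
  rwa [hyx, sub_zero] at this

theorem exists_eq_add_of_coset_sums_eq_zero [DecidableEq G] {P : Subgroup G} [DecidablePred (· ∈ P)]
    {r s : G} (hP : P ≤ Subgroup.closure {r, s}) {x : MonoidAlgebra ℤ G}
    (hx : ∀ k, pairing (fun g => if g ∈ P then 1 else 0) (MonoidAlgebra.of ℤ G k * x) = 0) :
    ∃ y z, x = y * (MonoidAlgebra.of ℤ G r - 1) + z * (MonoidAlgebra.of ℤ G s - 1) := by
  have := mem_of_coset_sums_eq_zero hP
    (I := Submodule.span _ {MonoidAlgebra.of ℤ G r - 1, MonoidAlgebra.of ℤ G s - 1})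
    (by
      rintro g (rfl | rfl)
      · exact Submodule.subset_span (by simp)
      · exact Submodule.subset_span (by simp)) (x := x) (by convert hx)
  obtain ⟨y, z, h⟩ := Submodule.mem_span_pair.1 this
  exact ⟨y, z, h.symm⟩

theorem exists_eq_of_coset_sums_eq_zero {s : G} [DecidablePred (· ∈ Subgroup.zpowers s)]
    {x : MonoidAlgebra ℤ G}
    (hx : ∀ k, pairing (fun g => if g ∈ Subgroup.zpowers s then 1 else 0)
      (MonoidAlgebra.of ℤ G k * x) = 0) :
    ∃ y, x = y * (MonoidAlgebra.of ℤ G s - 1) := by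
  have := mem_of_coset_sums_eq_zero (Subgroup.zpowers_eq_closure s).le
    (I := Submodule.span _ {MonoidAlgebra.of ℤ G s - 1})
    (by
      rintro g rfl
      exact Submodule.subset_span rfl) (x := x) (by convert hx)
  obtain ⟨y, h⟩ := Submodule.mem_span_singleton.1 this
  exact ⟨y, h.symm⟩

/-- The norm element of a cyclic subgroup of order `n`. -/
noncomputable def cyclicNorm (s : G) (n : ℕ) : MonoidAlgebra ℤ G :=
  ∑ i ∈ Finset.range n, MonoidAlgebra.of ℤ G (s ^ i)

open Classical in
theorem sum_range_pow_eq {s : G} (hs : IsOfFinOrder s) (g : G) :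
    (∑ i ∈ Finset.range (orderOf s), if g * s ^ i = 1 then (1 : ℤ) else 0) =
      if g ∈ Subgroup.zpowers s then 1 else 0 := by
  split_ifs with h
  · have h' : g⁻¹ ∈ Subgroup.zpowers s := inv_mem h
    rw [hs.mem_zpowers_iff_mem_range_orderOf] at h'
    obtain ⟨i, hi, hi'⟩ := Finset.mem_image.1 h'
    rw [Finset.sum_eq_single_of_mem i hi, if_pos (by rw [hi']; simp)]
    intro j hj hji
    refine if_neg fun hg => hji ?_
    have : s ^ j = s ^ i := by rw [hi', eq_inv_of_mul_eq_one_right hg]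
    exact pow_injOn_Iio_orderOf (by simpa using hj) (by simpa using hi) this
  · refine Finset.sum_eq_zero fun i _ => if_neg fun hg => h ?_
    rw [eq_inv_of_mul_eq_one_left hg]
    exact inv_mem (Subgroup.pow_mem _ (Subgroup.mem_zpowers s) i)

theorem exists_eq_mul_sub_one {s : G} (hs : IsOfFinOrder s) {x : MonoidAlgebra ℤ G}
    (h : x * cyclicNorm s (orderOf s) = 0) : ∃ y, x = y * (MonoidAlgebra.of ℤ G s - 1) := by
  classical
  refine exists_eq_of_coset_sums_eq_zero fun k => ?_
  have h' : pairing (fun g => if g = 1 then 1 else 0)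
      (MonoidAlgebra.of ℤ G k * x * cyclicNorm s (orderOf s)) = 0 := by
    rw [mul_assoc, h, mul_zero, map_zero]
  rw [cyclicNorm, Finset.mul_sum, map_sum] at h'
  simp only [pairing_mul_of] at h'
  rw [← pairing_finset_sum] at h'
  simpa only [sum_range_pow_eq hs] using h'

theorem coeff_mul_of_eq {s : G} {x : MonoidAlgebra ℤ G}
    (h : x * (MonoidAlgebra.of ℤ G s - 1) = 0) (g : G) : x.coeff (g * s) = x.coeff g := by
  classical
  rw [mul_sub, mul_one, sub_eq_zero] at h
  conv_lhs => rw [← h]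
  rw [coeff_eq_pairing, pairing_mul_of, coeff_eq_pairing]
  simp

theorem coeff_mul_zpow_eq {s : G} {x : MonoidAlgebra ℤ G}
    (h : x * (MonoidAlgebra.of ℤ G s - 1) = 0) (g : G) {k : G} (hk : k ∈ Subgroup.zpowers s) :
    x.coeff (g * k) = x.coeff g := by
  rw [Subgroup.zpowers_eq_closure] at hk
  induction hk using Subgroup.closure_induction generalizing g with
  | mem k hk => rw [Set.mem_singleton_iff.1 hk, coeff_mul_of_eq h]
  | one => rw [mul_one]
  | mul k l _ _ hk hl => rw [← mul_assoc, hl, hk]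
  | inv k _ hk => rw [← hk (g * k⁻¹), inv_mul_cancel_right]

theorem eq_zero_of_mul_sub_one {s : G} (hs : ¬ IsOfFinOrder s) {x : MonoidAlgebra ℤ G}
    (h : x * (MonoidAlgebra.of ℤ G s - 1) = 0) : x = 0 := by
  by_contra hx
  have hx' : x.coeff ≠ 0 := fun h0 => hx (by ext g; rw [h0]; rfl)
  obtain ⟨g, hg⟩ := Finsupp.ne_iff.1 hx'
  have hinj : Function.Injective fun n : ℕ => g * s ^ n := fun m n hmn =>
    injective_pow_iff_not_isOfFinOrder.2 hs (mul_left_cancel hmn)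
  refine Set.infinite_of_injective_forall_mem (s := (x.coeff.support : Set G)) hinj (fun n => ?_)
    x.coeff.support.finite_toSet
  rw [Finset.mem_coe, Finsupp.mem_support_iff,
    coeff_mul_zpow_eq h g (Subgroup.pow_mem _ (Subgroup.mem_zpowers s) n)]
  exact hg

theorem exists_eq_mul_cyclicNorm {s : G} (hs : IsOfFinOrder s) {x : MonoidAlgebra ℤ G}
    (h : x * (MonoidAlgebra.of ℤ G s - 1) = 0) : ∃ y, x = y * cyclicNorm s (orderOf s) := by
  classical
  let ρ : G → G := fun g => Quotient.out (QuotientGroup.mk (s := Subgroup.zpowers s) g)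
  have hρ : ∀ g, (ρ g)⁻¹ * g ∈ Subgroup.zpowers s := fun g => QuotientGroup.eq.1 (Quotient.out_eq _)
  let y : MonoidAlgebra ℤ G := ⟨x.coeff.filter fun g => ρ g = g⟩
  have hy : ∀ g, y.coeff g = if ρ g = g then x.coeff g else 0 := fun g =>
    Finsupp.filter_apply _ _ _
  refine ⟨y, ?_⟩
  ext g
  have hN : (y * cyclicNorm s (orderOf s)).coeff g =
      ∑ i ∈ Finset.range (orderOf s), y.coeff (g * (s ^ i)⁻¹) := by
    rw [coeff_eq_pairing, cyclicNorm, Finset.mul_sum, map_sum]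
    simp only [pairing_mul_of, coeff_eq_pairing, eq_mul_inv_iff_mul_eq]
  have hk := sum_range_pow_eq hs (g⁻¹ * ρ g)
  rw [if_pos (by simpa using inv_mem (hρ g))] at hk
  rw [hN, ← mul_one (x.coeff g), ← hk, Finset.mul_sum]
  refine Finset.sum_congr rfl fun i _ => ?_
  have hi : ρ (g * (s ^ i)⁻¹) = ρ g := by
    simp only [ρ]
    congr 1
    refine QuotientGroup.eq.2 ?_
    simp
  rw [hy, hi, coeff_mul_zpow_eq h g (inv_mem (Subgroup.pow_mem _ (Subgroup.mem_zpowers s) i)),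
    mul_ite, mul_one, mul_zero]
  refine if_congr ?_ rfl rfl
  rw [mul_assoc, inv_mul_eq_one, eq_mul_inv_iff_mul_eq, eq_comm]

end GroupRing

section RowMap

variable {R ι κ : Type} [Ring R] [Fintype ι] [Fintype κ]

/-- Right multiplication of row vectors by a matrix, for finitely supported row vectors. -/
noncomputable def rowMap (D : Matrix ι κ R) : (ι →₀ R) →ₗ[R] (κ →₀ R) :=
  Finsupp.linearCombination R fun i => Finsupp.equivFunOnFinite.symm (D i)

theorem rowMap_apply (D : Matrix ι κ R) (x : ι →₀ R) (j : κ) :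
    rowMap D x j = ∑ i, x i * D i j := by
  rw [rowMap, Finsupp.linearCombination_apply, Finsupp.sum_fintype _ _ (by simp),
    Finsupp.finsetSum_apply]
  rfl

theorem rowMap_eq_zero_iff (D : Matrix ι κ R) (x : ι →₀ R) :
    rowMap D x = 0 ↔ ∀ j, ∑ i, x i * D i j = 0 := by
  simp only [Finsupp.ext_iff, rowMap_apply, Finsupp.zero_apply]

theorem rowMap_exact {μ : Type} [Fintype μ] {D : Matrix ι κ R} {E : Matrix κ μ R}
    (h : D * E = 0)
    (h' : ∀ x : κ → R, (∀ j, ∑ i, x i * E i j = 0) → ∃ y : ι → R, ∀ j, ∑ i, y i * D i j = x j) :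
    Function.Exact (rowMap D) (rowMap E) := by
  intro x
  rw [rowMap_eq_zero_iff]
  constructor
  · intro hx
    obtain ⟨y, hy⟩ := h' x hx
    exact ⟨Finsupp.equivFunOnFinite.symm y, by ext j; rw [rowMap_apply]; exact hy j⟩
  · rintro ⟨y, rfl⟩ j
    simp only [rowMap_apply, Finset.sum_mul]
    rw [Finset.sum_comm]
    simp only [mul_assoc, ← Finset.mul_sum]
    refine Finset.sum_eq_zero fun i _ => ?_
    have := congrFun (congrFun h i) j
    rw [Matrix.mul_apply] at this
    rw [this, Matrix.zero_apply, mul_zero]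

end RowMap

open Classical in
/-- Elements `a`, `b`, `u`, `c` of a group for which the complex with boundary matrices
`boundaryMatrix a b u c` is a free resolution: the group is an iterated HNN extension with
finite cyclic or infinite cyclic data, witnessed by functions on the group that change along one
stable letter only. -/
structure IsResolvingTuple {G : Type} [Group G] (a b u c : G) : Prop where
  orderOf_a : orderOf a = 2
  orderOf_b : orderOf b = 3
  not_isOfFinOrder : ¬ IsOfFinOrder (a * b)
  comm_u : a * b * u = u * (a * b)
  comm_c : a * c = c * a
  comm_w : b * (a * u * c * u) = a * u * c * u * b
  closure_eq : Subgroup.closure {a, b, u, c} = ⊤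
  separating_c : ∃ Φ : G → ℤ, (∀ g, Φ (g * a) = Φ g) ∧ (∀ g, Φ (g * b) = Φ g) ∧
    (∀ g, Φ (g * u) = Φ g) ∧ ∀ g, Φ (g * c) - Φ g =
      if g ∈ Subgroup.closure {a, (a * u)⁻¹ * b * (a * u)} then 1 else 0
  separating_u : ∃ Φ : G → ℤ, (∀ g, Φ (g * a) = Φ g) ∧ (∀ g, Φ (g * b) = Φ g) ∧
    ∀ g, Φ (g * u) - Φ g = if g ∈ Subgroup.zpowers (a * b) then 1 else 0
  separating_ab : ∃ Φ Ψ : G → ℤ, (∀ g, Φ (g * a) = Φ g) ∧ (∀ g, Ψ (g * b) = Ψ g) ∧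
    ∀ g, Ψ g - Φ g = if g = 1 then 1 else 0
  separating_ab' : ∃ Φ Ψ : G → ℤ, (∀ g, Φ (g * a) = Φ g) ∧
    (∀ g, Ψ (g * ((a * u)⁻¹ * b * (a * u))) = Ψ g) ∧ ∀ g, Ψ g - Φ g = if g = 1 then 1 else 0

/-- The ranks of the free modules in the resolution. -/
def resolutionRank : ℕ → ℕ
  | 0 => 1
  | 1 => 4
  | 2 => 5
  | _ + 3 => 4

section Matrices

variable {R : Type} [Ring R] (a b u c : R)

/-- The boundary matrices of the resolution, with entries written in the images `a`, `b`, `u`, `c`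
of the generators in a ring. -/
def boundaryMatrix : (n : ℕ) → Matrix (Fin (resolutionRank (n + 1))) (Fin (resolutionRank n)) R
  | 0 => (!![a - 1; b - 1; u - 1; c - 1] : Matrix (Fin 4) (Fin 1) R)
  | 1 => (!![1 + a, 0, 0, 0;
            0, 1 + b + b * b, 0, 0;
            1 - u, (1 - u) * a, a * b - 1, 0;
            1 - c, 0, 0, a - 1;
            b - 1, 1 - a * u * c * u, (b - 1) * (a + a * u * c), (b - 1) * (a * u)] :
              Matrix (Fin 5) (Fin 4) R)
  | 2 => (!![a - 1, 0, 0, 0, 0;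
            0, b - 1, 0, 0, 0;
            -(1 - c), 0, 0, 1 + a, 0;
            0, -(1 - a * u * c * u), 0, 0, 1 + b + b * b] : Matrix (Fin 4) (Fin 5) R)
  | 3 => (!![1 + a, 0, 0, 0;
            0, 1 + b + b * b, 0, 0;
            1 - c, 0, a - 1, 0;
            0, 1 - a * u * c * u, 0, b - 1] : Matrix (Fin 4) (Fin 4) R)
  | 4 => (!![a - 1, 0, 0, 0;
            0, b - 1, 0, 0;
            -(1 - c), 0, 1 + a, 0;
            0, -(1 - a * u * c * u), 0, 1 + b + b * b] : Matrix (Fin 4) (Fin 4) R)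
  | n + 5 => boundaryMatrix (n + 3)

theorem boundaryMatrix_map {S : Type} [Ring S] (φ : R →+* S) (n : ℕ) (i j) :
    φ (boundaryMatrix a b u c n i j) = boundaryMatrix (φ a) (φ b) (φ u) (φ c) n i j := by
  induction n using Nat.strong_induction_on with
  | _ n ih =>
    match n with
    | 0 =>
      revert i j
      change ∀ (i : Fin 4) (j : Fin 1), _
      intro i j
      fin_cases i <;> fin_cases j <;> simp [boundaryMatrix]
    | 1 =>
      revert i j
      change ∀ (i : Fin 5) (j : Fin 4), _
      intro i j
      fin_cases i <;> fin_cases j <;> simp [boundaryMatrix]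
    | 2 =>
      revert i j
      change ∀ (i : Fin 4) (j : Fin 5), _
      intro i j
      fin_cases i <;> fin_cases j <;> simp [boundaryMatrix]
    | 3 =>
      revert i j
      change ∀ (i : Fin 4) (j : Fin 4), _
      intro i j
      fin_cases i <;> fin_cases j <;> simp [boundaryMatrix]
    | 4 =>
      revert i j
      change ∀ (i : Fin 4) (j : Fin 4), _
      intro i j
      fin_cases i <;> fin_cases j <;> simp [boundaryMatrix]
    | n + 5 => exact ih (n + 3) (by omega) i j

end Matrices

section Relations

variable {R : Type} [Ring R] {a b u c : R}

theorem relator_u (hu : a * b * u = u * (a * b)) :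
    (1 - u) * (a - 1) + (1 - u) * a * (b - 1) + (a * b - 1) * (u - 1) = 0 := by
  rw [← sub_eq_zero] at hu
  rw [← hu]
  noncomm_ring

theorem relator_c (hc : a * c = c * a) : (1 - c) * (a - 1) + (a - 1) * (c - 1) = 0 := by
  rw [← sub_eq_zero] at hc
  rw [← hc]
  noncomm_ring

theorem relator_w (hw : b * (a * u * c * u) = a * u * c * u * b) :
    (b - 1) * (a - 1) + (1 - a * u * c * u) * (b - 1) + (b - 1) * (a + a * u * c) * (u - 1) +
      (b - 1) * (a * u) * (c - 1) = 0 := by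
  rw [← sub_eq_zero] at hw
  rw [← hw]
  noncomm_ring

theorem boundaryMatrix_mul_boundaryMatrix (ha : a * a = 1) (hb : b * b * b = 1)
    (hu : a * b * u = u * (a * b)) (hc : a * c = c * a)
    (hw : b * (a * u * c * u) = a * u * c * u * b) (n : ℕ) :
    boundaryMatrix a b u c (n + 1) * boundaryMatrix a b u c n = 0 := by
  have a₁ : (1 + a) * (a - 1) = 0 := by
    rw [show (1 + a) * (a - 1) = a * a - 1 by noncomm_ring, ha, sub_self]
  have a₂ : (a - 1) * (1 + a) = 0 := by
    rw [show (a - 1) * (1 + a) = a * a - 1 by noncomm_ring, ha, sub_self]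
  have b₁ : (1 + b + b * b) * (b - 1) = 0 := by
    rw [show (1 + b + b * b) * (b - 1) = b * b * b - 1 by noncomm_ring, hb, sub_self]
  have b₂ : (b - 1) * (1 + b + b * b) = 0 := by
    rw [show (b - 1) * (1 + b + b * b) = b * b * b - 1 by noncomm_ring, hb, sub_self]
  have hw' : (1 + b + b * b) * (a * u * c * u) = a * u * c * u * (1 + b + b * b) := by
    rw [add_mul, add_mul, mul_assoc b b, hw, ← mul_assoc b, hw, one_mul, mul_add, mul_add, mul_one,
      mul_assoc (a * u * c * u) b b]
  have k := relator_w hw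
  generalize hW : a * u * c * u = w at *
  have c₁ : (c - 1) * (1 + a) + (1 + a) * (1 - c) = 0 := by
    rw [← sub_eq_zero] at hc
    rw [← neg_zero, ← hc]
    noncomm_ring
  have c₂ := relator_c hc
  have w₁ : (w - 1) * (1 + b + b * b) + (1 + b + b * b) * (1 - w) = 0 := by
    rw [sub_mul, mul_sub, hw']
    noncomm_ring
  have w₂ := relator_c hw
  induction n using Nat.strong_induction_on with
  | _ n ih =>
    match n with
    | 0 =>
      ext i j
      rw [Matrix.mul_apply, Matrix.zero_apply]
      revert i j
      change ∀ (i : Fin 5) (j : Fin 1), ∑ k : Fin 4, _ = _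
      intro i j
      rw [Fin.sum_univ_four]
      fin_cases i <;> fin_cases j
      · simpa [boundaryMatrix] using a₁
      · simpa [boundaryMatrix] using b₁
      · simpa [boundaryMatrix] using relator_u hu
      · simpa [boundaryMatrix] using c₂
      · simpa [boundaryMatrix, hW] using k
    | 1 =>
      ext i j
      rw [Matrix.mul_apply, Matrix.zero_apply]
      revert i j
      change ∀ (i : Fin 4) (j : Fin 4), ∑ k : Fin 5, _ = _
      intro i j
      rw [Fin.sum_univ_five]
      fin_cases i <;> fin_cases j <;>
        simp [boundaryMatrix, hW, ← mul_assoc, a₁, a₂, b₁, b₂, c₁, w₁]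
    | 2 =>
      ext i j
      rw [Matrix.mul_apply, Matrix.zero_apply]
      revert i j
      change ∀ (i : Fin 4) (j : Fin 5), ∑ k : Fin 4, _ = _
      intro i j
      rw [Fin.sum_univ_four]
      fin_cases i <;> fin_cases j <;>
        simp [boundaryMatrix, hW, a₁, a₂, b₁, b₂, c₂, w₂]
    | 3 =>
      ext i j
      rw [Matrix.mul_apply, Matrix.zero_apply]
      revert i j
      change ∀ (i : Fin 4) (j : Fin 4), ∑ k : Fin 4, _ = _
      intro i j
      rw [Fin.sum_univ_four]
      fin_cases i <;> fin_cases j <;>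
        simp [boundaryMatrix, hW, a₁, a₂, b₁, b₂, c₁, w₁]
    | 4 =>
      ext i j
      rw [Matrix.mul_apply, Matrix.zero_apply]
      revert i j
      change ∀ (i : Fin 4) (j : Fin 4), ∑ k : Fin 4, _ = _
      intro i j
      rw [Fin.sum_univ_four]
      fin_cases i <;> fin_cases j <;>
        simp [boundaryMatrix, hW, a₁, a₂, b₁, b₂, c₂, w₂]
    | n + 5 => exact ih (n + 3) (by omega)

end Relations


namespace IsResolvingTuple

open MonoidAlgebra (of)

variable {G : Type} [Group G] {a b u c : G}


theorem of_a_mul_self (h : IsResolvingTuple a b u c) : of ℤ G a * of ℤ G a = 1 := by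
  rw [← map_mul, ← sq, ← h.orderOf_a, pow_orderOf_eq_one, map_one]

theorem of_b_mul_self (h : IsResolvingTuple a b u c) : of ℤ G b * of ℤ G b * of ℤ G b = 1 := by
  rw [← map_mul, ← map_mul, ← pow_three', ← h.orderOf_b, pow_orderOf_eq_one, map_one]

theorem of_comm_u (h : IsResolvingTuple a b u c) :
    of ℤ G a * of ℤ G b * of ℤ G u = of ℤ G u * (of ℤ G a * of ℤ G b) := by
  simp only [← map_mul, h.comm_u]

theorem of_comm_c (h : IsResolvingTuple a b u c) : of ℤ G a * of ℤ G c = of ℤ G c * of ℤ G a := by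
  simp only [← map_mul, h.comm_c]

theorem of_comm_w (h : IsResolvingTuple a b u c) :
    of ℤ G b * (of ℤ G a * of ℤ G u * of ℤ G c * of ℤ G u) =
      of ℤ G a * of ℤ G u * of ℤ G c * of ℤ G u * of ℤ G b := by
  simp only [← map_mul, h.comm_w]

theorem isOfFinOrder_a (h : IsResolvingTuple a b u c) : IsOfFinOrder a :=
  orderOf_pos_iff.1 (by rw [h.orderOf_a]; norm_num)

theorem isOfFinOrder_b (h : IsResolvingTuple a b u c) : IsOfFinOrder b :=
  orderOf_pos_iff.1 (by rw [h.orderOf_b]; norm_num)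

theorem cyclicNorm_a (h : IsResolvingTuple a b u c) : cyclicNorm a (orderOf a) = 1 + of ℤ G a := by
  rw [h.orderOf_a]
  simp [cyclicNorm, Finset.sum_range_succ, MonoidAlgebra.one_def]

theorem cyclicNorm_b (h : IsResolvingTuple a b u c) :
    cyclicNorm b (orderOf b) = 1 + of ℤ G b + of ℤ G b * of ℤ G b := by
  rw [h.orderOf_b]
  simp only [cyclicNorm, Finset.sum_range_succ, map_pow]
  simp [sq]

theorem exists_mul_norm_a (h : IsResolvingTuple a b u c) {x : MonoidAlgebra ℤ G}
    (hx : x * (of ℤ G a - 1) = 0) : ∃ y, x = y * (1 + of ℤ G a) := by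
  obtain ⟨y, hy⟩ := exists_eq_mul_cyclicNorm h.isOfFinOrder_a hx
  exact ⟨y, by rw [hy, h.cyclicNorm_a]⟩

theorem exists_mul_norm_b (h : IsResolvingTuple a b u c) {x : MonoidAlgebra ℤ G}
    (hx : x * (of ℤ G b - 1) = 0) : ∃ y, x = y * (1 + of ℤ G b + of ℤ G b * of ℤ G b) := by
  obtain ⟨y, hy⟩ := exists_eq_mul_cyclicNorm h.isOfFinOrder_b hx
  exact ⟨y, by rw [hy, h.cyclicNorm_b]⟩

theorem exists_mul_a_sub_one (h : IsResolvingTuple a b u c) {x : MonoidAlgebra ℤ G}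
    (hx : x * (1 + of ℤ G a) = 0) : ∃ y, x = y * (of ℤ G a - 1) :=
  exists_eq_mul_sub_one h.isOfFinOrder_a (by rw [h.cyclicNorm_a, hx])

theorem exists_mul_b_sub_one (h : IsResolvingTuple a b u c) {x : MonoidAlgebra ℤ G}
    (hx : x * (1 + of ℤ G b + of ℤ G b * of ℤ G b) = 0) : ∃ y, x = y * (of ℤ G b - 1) :=
  exists_eq_mul_sub_one h.isOfFinOrder_b (by rw [h.cyclicNorm_b, hx])

theorem eq_zero_of_mul_ab (h : IsResolvingTuple a b u c) {x : MonoidAlgebra ℤ G}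
    (hx : x * (of ℤ G a * of ℤ G b - 1) = 0) : x = 0 :=
  eq_zero_of_mul_sub_one h.not_isOfFinOrder (by rw [map_mul, hx])

theorem sub_one_mul_conj (s v : G) :
    of ℤ G v * (of ℤ G (v⁻¹ * s * v) - 1) =
      (of ℤ G s - 1) * of ℤ G v := by
  rw [mul_sub, sub_mul, ← map_mul, ← map_mul]
  simp [mul_assoc]

theorem exists_coeff_c (h : IsResolvingTuple a b u c) {x y z w : MonoidAlgebra ℤ G}
    (hx : x * (of ℤ G a - 1) + y * (of ℤ G b - 1) + z * (of ℤ G u - 1) + w * (of ℤ G c - 1) = 0) :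
    ∃ p q, w = p * (of ℤ G a - 1) + q * ((of ℤ G b - 1) * (of ℤ G a * of ℤ G u)) := by
  classical
  obtain ⟨Φ, ha, hb, hu, hc⟩ := h.separating_c
  obtain ⟨p, q, hpq⟩ : ∃ p q, w = p * (of ℤ G a - 1) +
      q * (of ℤ G ((a * u)⁻¹ * b * (a * u)) - 1) := by
    refine exists_eq_add_of_coset_sums_eq_zero le_rfl fun k => ?_
    have := congrArg (fun x => pairing Φ (of ℤ G k * x)) hx
    simp only [mul_add, ← mul_assoc, map_add, mul_zero, map_zero,
      pairing_mul_of_sub_one_eq_zero ha, pairing_mul_of_sub_one_eq_zero hb,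
      pairing_mul_of_sub_one_eq_zero hu, zero_add] at this
    rw [pairing_mul_of_sub_one] at this
    simpa only [hc] using this
  refine ⟨p, q * of ℤ G (a * u)⁻¹, ?_⟩
  rw [hpq, ← map_mul, ← sub_one_mul_conj, mul_assoc q, ← mul_assoc (of ℤ G (a * u)⁻¹),
    ← map_mul, inv_mul_cancel, map_one, one_mul]

theorem exists_coeff_u (h : IsResolvingTuple a b u c) {x y z : MonoidAlgebra ℤ G}
    (hx : x * (of ℤ G a - 1) + y * (of ℤ G b - 1) + z * (of ℤ G u - 1) = 0) :
    ∃ p, z = p * (of ℤ G a * of ℤ G b - 1) := by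
  classical
  obtain ⟨Φ, ha, hb, hu⟩ := h.separating_u
  rw [← map_mul]
  refine exists_eq_of_coset_sums_eq_zero fun k => ?_
  have := congrArg (fun x => pairing Φ (of ℤ G k * x)) hx
  simp only [mul_add, ← mul_assoc, map_add, mul_zero, map_zero,
    pairing_mul_of_sub_one_eq_zero ha, pairing_mul_of_sub_one_eq_zero hb, zero_add] at this
  rw [pairing_mul_of_sub_one] at this
  simpa only [hu] using this

open Classical in
theorem eq_zero_of_separating {s r : G}
    (h : ∃ Φ Ψ : G → ℤ, (∀ g, Φ (g * s) = Φ g) ∧ (∀ g, Ψ (g * r) = Ψ g) ∧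
      ∀ g, Ψ g - Φ g = if g = 1 then 1 else 0) {x y : MonoidAlgebra ℤ G}
    (hx : x * (of ℤ G s - 1) + y * (of ℤ G r - 1) = 0) :
    x * (of ℤ G s - 1) = 0 ∧ y * (of ℤ G r - 1) = 0 := by
  obtain ⟨Φ, Ψ, hs, hr, h⟩ := h
  have key : x * (of ℤ G s - 1) = 0 := by
    refine eq_zero_of_pairing fun k => ?_
    have e : x * (of ℤ G s - 1) = -y * (of ℤ G r - 1) := by
      rw [neg_mul]
      exact eq_neg_of_add_eq_zero_left hx
    simp only [← h]
    rw [pairing_sub, ← mul_assoc, pairing_mul_of_sub_one_eq_zero hs, mul_assoc, e, ← mul_assoc,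
      pairing_mul_of_sub_one_eq_zero hr, sub_zero]
  exact ⟨key, by rwa [key, zero_add] at hx⟩

theorem eq_zero_of_coeff_ab (h : IsResolvingTuple a b u c) {x y : MonoidAlgebra ℤ G}
    (hx : x * (of ℤ G a - 1) + y * (of ℤ G b - 1) = 0) :
    x * (of ℤ G a - 1) = 0 ∧ y * (of ℤ G b - 1) = 0 :=
  eq_zero_of_separating h.separating_ab hx

theorem eq_zero_of_coeff_ab' (h : IsResolvingTuple a b u c) {x y : MonoidAlgebra ℤ G}
    (hx : x * (of ℤ G a - 1) + y * ((of ℤ G b - 1) * (of ℤ G a * of ℤ G u)) = 0) :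
    x * (of ℤ G a - 1) = 0 ∧ y * (of ℤ G b - 1) = 0 := by
  rw [← map_mul, ← sub_one_mul_conj, ← mul_assoc] at hx
  obtain ⟨h₁, h₂⟩ := eq_zero_of_separating h.separating_ab' hx
  refine ⟨h₁, ?_⟩
  rw [mul_assoc, sub_one_mul_conj, ← mul_assoc] at h₂
  have := congrArg (· * of ℤ G (a * u)⁻¹) h₂
  simpa only [mul_assoc, ← map_mul, mul_inv_cancel, map_one, mul_one, zero_mul] using this


theorem boundaryMatrix_mul (h : IsResolvingTuple a b u c) (n : ℕ) :
    boundaryMatrix (of ℤ G a) (of ℤ G b) (of ℤ G u) (of ℤ G c) (n + 1) *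
      boundaryMatrix (of ℤ G a) (of ℤ G b) (of ℤ G u) (of ℤ G c) n = 0 :=
  boundaryMatrix_mul_boundaryMatrix h.of_a_mul_self h.of_b_mul_self h.of_comm_u h.of_comm_c
    h.of_comm_w n

theorem exact_zero (h : IsResolvingTuple a b u c) :
    Function.Exact (rowMap (boundaryMatrix (of ℤ G a) (of ℤ G b) (of ℤ G u) (of ℤ G c) 1))
      (rowMap (boundaryMatrix (of ℤ G a) (of ℤ G b) (of ℤ G u) (of ℤ G c) 0)) := by
  refine rowMap_exact (h.boundaryMatrix_mul 0) ?_
  change ∀ x : Fin 4 → MonoidAlgebra ℤ G, (∀ j : Fin 1, ∑ i : Fin 4, _ = _) →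
    ∃ y : Fin 5 → MonoidAlgebra ℤ G, ∀ j : Fin 4, ∑ i : Fin 5, _ = _
  intro x hx
  replace hx := hx 0
  rw [Fin.sum_univ_four] at hx
  change x 0 * (of ℤ G a - 1) + x 1 * (of ℤ G b - 1) + x 2 * (of ℤ G u - 1) +
    x 3 * (of ℤ G c - 1) = 0 at hx
  obtain ⟨p, q, hc⟩ := h.exists_coeff_c hx
  obtain ⟨r, hu⟩ := h.exists_coeff_u (x := x 0 - p * (1 - of ℤ G c) - q * (of ℤ G b - 1))
    (y := x 1 - q * (1 - of ℤ G a * of ℤ G u * of ℤ G c * of ℤ G u))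
    (z := x 2 - q * ((of ℤ G b - 1) * (of ℤ G a + of ℤ G a * of ℤ G u * of ℤ G c)))
    (by linear_combination (norm := noncomm_ring)
          hx - hc * (of ℤ G c - 1) - p * relator_c h.of_comm_c - q * relator_w h.of_comm_w)
  obtain ⟨ha, hb⟩ := h.eq_zero_of_coeff_ab
    (x := x 0 - p * (1 - of ℤ G c) - q * (of ℤ G b - 1) - r * (1 - of ℤ G u))
    (y := x 1 - q * (1 - of ℤ G a * of ℤ G u * of ℤ G c * of ℤ G u) - r * (1 - of ℤ G u) * of ℤ G a)
    (by linear_combination (norm := noncomm_ring)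
          hx - hc * (of ℤ G c - 1) - p * relator_c h.of_comm_c - q * relator_w h.of_comm_w -
            hu * (of ℤ G u - 1) - r * relator_u h.of_comm_u)
  obtain ⟨s, hs⟩ := h.exists_mul_norm_a ha
  obtain ⟨v, hv⟩ := h.exists_mul_norm_b hb
  refine ⟨![s, v, r, p, q], fun j => ?_⟩
  rw [Fin.sum_univ_five]
  fin_cases j <;> simp [boundaryMatrix, -MonoidAlgebra.of_apply]
  · linear_combination (norm := noncomm_ring) -hs
  · linear_combination (norm := noncomm_ring) -hv
  · linear_combination (norm := noncomm_ring) -hu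
  · linear_combination (norm := noncomm_ring) -hc

theorem norm_comm_c (h : IsResolvingTuple a b u c) :
    (1 + of ℤ G a) * (1 - of ℤ G c) = (1 - of ℤ G c) * (1 + of ℤ G a) := by
  linear_combination (norm := noncomm_ring) -h.of_comm_c

theorem norm_comm_w (h : IsResolvingTuple a b u c) :
    (1 + of ℤ G b + of ℤ G b * of ℤ G b) * (1 - of ℤ G a * of ℤ G u * of ℤ G c * of ℤ G u) =
      (1 - of ℤ G a * of ℤ G u * of ℤ G c * of ℤ G u) *
        (1 + of ℤ G b + of ℤ G b * of ℤ G b) := by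
  linear_combination (norm := noncomm_ring)
    -h.of_comm_w - of ℤ G b * h.of_comm_w - h.of_comm_w * of ℤ G b

theorem exact_one (h : IsResolvingTuple a b u c) :
    Function.Exact (rowMap (boundaryMatrix (of ℤ G a) (of ℤ G b) (of ℤ G u) (of ℤ G c) 2))
      (rowMap (boundaryMatrix (of ℤ G a) (of ℤ G b) (of ℤ G u) (of ℤ G c) 1)) := by
  refine rowMap_exact (h.boundaryMatrix_mul 1) ?_
  change ∀ x : Fin 5 → MonoidAlgebra ℤ G, (∀ j : Fin 4, ∑ i : Fin 5, _ = _) →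
    ∃ y : Fin 4 → MonoidAlgebra ℤ G, ∀ j : Fin 5, ∑ i : Fin 4, _ = _
  intro x hx
  simp only [Fin.sum_univ_five, Fin.forall_fin_succ, Fin.isValue] at hx
  simp [boundaryMatrix, -MonoidAlgebra.of_apply] at hx
  obtain ⟨h₀, h₁, h₂, h₃⟩ := hx
  obtain ⟨hc, hw⟩ := h.eq_zero_of_coeff_ab' h₃
  have hu : x 2 = 0 := h.eq_zero_of_mul_ab (by
    linear_combination (norm := noncomm_ring)
      h₂ - hw * (of ℤ G a + of ℤ G a * of ℤ G u * of ℤ G c))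
  obtain ⟨z, hz⟩ := h.exists_mul_norm_a hc
  obtain ⟨v, hv⟩ := h.exists_mul_norm_b hw
  obtain ⟨p, hp⟩ := h.exists_mul_a_sub_one (x := x 0 + z * (1 - of ℤ G c)) (by
    linear_combination (norm := noncomm_ring)
      h₀ - hu * (1 - of ℤ G u) - hz * (1 - of ℤ G c) - hw - z * h.norm_comm_c)
  obtain ⟨q, hq⟩ := h.exists_mul_b_sub_one
    (x := x 1 + v * (1 - of ℤ G a * of ℤ G u * of ℤ G c * of ℤ G u)) (by
    linear_combination (norm := noncomm_ring)
      h₁ - hu * ((1 - of ℤ G u) * of ℤ G a) -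
        hv * (1 - of ℤ G a * of ℤ G u * of ℤ G c * of ℤ G u) - v * h.norm_comm_w)
  refine ⟨![p, q, z, v], fun j => ?_⟩
  rw [Fin.sum_univ_four]
  fin_cases j <;> simp [boundaryMatrix, -MonoidAlgebra.of_apply]
  · linear_combination (norm := noncomm_ring) -hp
  · linear_combination (norm := noncomm_ring) -hq
  · exact hu.symm
  · exact hz.symm
  · exact hv.symm

theorem exact_two (h : IsResolvingTuple a b u c) :
    Function.Exact (rowMap (boundaryMatrix (of ℤ G a) (of ℤ G b) (of ℤ G u) (of ℤ G c) 3))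
      (rowMap (boundaryMatrix (of ℤ G a) (of ℤ G b) (of ℤ G u) (of ℤ G c) 2)) := by
  refine rowMap_exact (h.boundaryMatrix_mul 2) ?_
  change ∀ x : Fin 4 → MonoidAlgebra ℤ G, (∀ j : Fin 5, ∑ i : Fin 4, _ = _) →
    ∃ y : Fin 4 → MonoidAlgebra ℤ G, ∀ j : Fin 4, ∑ i : Fin 4, _ = _
  intro x hx
  simp only [Fin.sum_univ_four, Fin.forall_fin_succ, Fin.isValue] at hx
  simp [boundaryMatrix, -MonoidAlgebra.of_apply] at hx
  obtain ⟨h₀, h₁, h₂, h₃⟩ := hx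
  obtain ⟨z, hz⟩ := h.exists_mul_a_sub_one h₂
  obtain ⟨v, hv⟩ := h.exists_mul_b_sub_one h₃
  obtain ⟨p, hp⟩ := h.exists_mul_norm_a (x := x 0 - z * (1 - of ℤ G c)) (by
    linear_combination (norm := noncomm_ring)
      h₀ - hz * (of ℤ G c - 1) - z * relator_c h.of_comm_c)
  obtain ⟨q, hq⟩ := h.exists_mul_norm_b
    (x := x 1 - v * (1 - of ℤ G a * of ℤ G u * of ℤ G c * of ℤ G u)) (by
    linear_combination (norm := noncomm_ring)
      h₁ - hv * (of ℤ G a * of ℤ G u * of ℤ G c * of ℤ G u - 1) - v * relator_c h.of_comm_w)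
  refine ⟨![p, q, z, v], fun j => ?_⟩
  rw [Fin.sum_univ_four]
  fin_cases j <;> simp [boundaryMatrix, -MonoidAlgebra.of_apply]
  · linear_combination (norm := noncomm_ring) -hp
  · linear_combination (norm := noncomm_ring) -hq
  · exact hz.symm
  · exact hv.symm

theorem exact_three (h : IsResolvingTuple a b u c) :
    Function.Exact (rowMap (boundaryMatrix (of ℤ G a) (of ℤ G b) (of ℤ G u) (of ℤ G c) 4))
      (rowMap (boundaryMatrix (of ℤ G a) (of ℤ G b) (of ℤ G u) (of ℤ G c) 3)) := by
  refine rowMap_exact (h.boundaryMatrix_mul 3) ?_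
  change ∀ x : Fin 4 → MonoidAlgebra ℤ G, (∀ j : Fin 4, ∑ i : Fin 4, _ = _) →
    ∃ y : Fin 4 → MonoidAlgebra ℤ G, ∀ j : Fin 4, ∑ i : Fin 4, _ = _
  intro x hx
  simp only [Fin.sum_univ_four, Fin.forall_fin_succ, Fin.isValue] at hx
  simp [boundaryMatrix, -MonoidAlgebra.of_apply] at hx
  obtain ⟨h₀, h₁, h₂, h₃⟩ := hx
  obtain ⟨z, hz⟩ := h.exists_mul_norm_a h₂
  obtain ⟨v, hv⟩ := h.exists_mul_norm_b h₃
  obtain ⟨p, hp⟩ := h.exists_mul_a_sub_one (x := x 0 + z * (1 - of ℤ G c)) (by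
    linear_combination (norm := noncomm_ring)
      h₀ - hz * (1 - of ℤ G c) - z * h.norm_comm_c)
  obtain ⟨q, hq⟩ := h.exists_mul_b_sub_one
    (x := x 1 + v * (1 - of ℤ G a * of ℤ G u * of ℤ G c * of ℤ G u)) (by
    linear_combination (norm := noncomm_ring)
      h₁ - hv * (1 - of ℤ G a * of ℤ G u * of ℤ G c * of ℤ G u) - v * h.norm_comm_w)
  refine ⟨![p, q, z, v], fun j => ?_⟩
  rw [Fin.sum_univ_four]
  fin_cases j <;> simp [boundaryMatrix, -MonoidAlgebra.of_apply]
  · linear_combination (norm := noncomm_ring) -hp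
  · linear_combination (norm := noncomm_ring) -hq
  · exact hz.symm
  · exact hv.symm

theorem exact_four (h : IsResolvingTuple a b u c) :
    Function.Exact (rowMap (boundaryMatrix (of ℤ G a) (of ℤ G b) (of ℤ G u) (of ℤ G c) 5))
      (rowMap (boundaryMatrix (of ℤ G a) (of ℤ G b) (of ℤ G u) (of ℤ G c) 4)) := by
  refine rowMap_exact (h.boundaryMatrix_mul 4) ?_
  change ∀ x : Fin 4 → MonoidAlgebra ℤ G, (∀ j : Fin 4, ∑ i : Fin 4, _ = _) →
    ∃ y : Fin 4 → MonoidAlgebra ℤ G, ∀ j : Fin 4, ∑ i : Fin 4, _ = _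
  intro x hx
  simp only [Fin.sum_univ_four, Fin.forall_fin_succ, Fin.isValue] at hx
  simp [boundaryMatrix, -MonoidAlgebra.of_apply] at hx
  obtain ⟨h₀, h₁, h₂, h₃⟩ := hx
  obtain ⟨z, hz⟩ := h.exists_mul_a_sub_one h₂
  obtain ⟨v, hv⟩ := h.exists_mul_b_sub_one h₃
  obtain ⟨p, hp⟩ := h.exists_mul_norm_a (x := x 0 - z * (1 - of ℤ G c)) (by
    linear_combination (norm := noncomm_ring)
      h₀ - hz * (of ℤ G c - 1) - z * relator_c h.of_comm_c)
  obtain ⟨q, hq⟩ := h.exists_mul_norm_b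
    (x := x 1 - v * (1 - of ℤ G a * of ℤ G u * of ℤ G c * of ℤ G u)) (by
    linear_combination (norm := noncomm_ring)
      h₁ - hv * (of ℤ G a * of ℤ G u * of ℤ G c * of ℤ G u - 1) - v * relator_c h.of_comm_w)
  refine ⟨![p, q, z, v], fun j => ?_⟩
  rw [Fin.sum_univ_four]
  fin_cases j <;> simp [boundaryMatrix, -MonoidAlgebra.of_apply]
  · linear_combination (norm := noncomm_ring) -hp
  · linear_combination (norm := noncomm_ring) -hq
  · exact hz.symm
  · exact hv.symm

theorem exact_rowMap (h : IsResolvingTuple a b u c) (n : ℕ) :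
    Function.Exact (rowMap (boundaryMatrix (of ℤ G a) (of ℤ G b) (of ℤ G u) (of ℤ G c) (n + 1)))
      (rowMap (boundaryMatrix (of ℤ G a) (of ℤ G b) (of ℤ G u) (of ℤ G c) n)) := by
  induction n using Nat.strong_induction_on with
  | _ n ih =>
    match n with
    | 0 => exact h.exact_zero
    | 1 => exact h.exact_one
    | 2 => exact h.exact_two
    | 3 => exact h.exact_three
    | 4 => exact h.exact_four
    | n + 5 => exact ih (n + 3) (by omega)

/-- The augmentation of the degree zero term of the resolution. -/
noncomputable def resolutionAugmentation (G : Type) [Group G] :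
    (Fin (resolutionRank 0) →₀ MonoidAlgebra ℤ G) →ₗ[ℤ] ℤ :=
  (augmentation G).toLinearMap ∘ₗ Finsupp.lapply ⟨0, Nat.one_pos⟩

theorem resolutionAugmentation_apply (G : Type) [Group G]
    (x : Fin (resolutionRank 0) →₀ MonoidAlgebra ℤ G) :
    resolutionAugmentation G x = augmentation G (x ⟨0, Nat.one_pos⟩) := rfl

theorem augmentation_eq_pairing (x : MonoidAlgebra ℤ G) :
    augmentation G x = pairing (fun _ => 1) x := by
  induction x using MonoidAlgebra.induction_linear with
  | zero => simp
  | add x y hx hy => rw [map_add, map_add, hx, hy]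
  | single g r => simp

theorem exists_of_augmentation_eq_zero (h : IsResolvingTuple a b u c) {x : MonoidAlgebra ℤ G}
    (hx : augmentation G x = 0) : ∃ p q r s : MonoidAlgebra ℤ G,
      p * (of ℤ G a - 1) + q * (of ℤ G b - 1) + r * (of ℤ G u - 1) + s * (of ℤ G c - 1) = x := by
  classical
  have key := mem_of_coset_sums_eq_zero (P := ⊤) h.closure_eq.ge (x := x)
    (I := Submodule.span _ ((fun s => of ℤ G s - 1) '' {a, b, u, c}))
    (fun s hs => Submodule.subset_span (Set.mem_image_of_mem _ hs)) (fun k => by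
      rw [pairing_of_mul]
      simpa [augmentation_eq_pairing] using hx)
  simp only [Set.image_insert_eq, Set.image_singleton, Submodule.mem_span_insert,
    Submodule.mem_span_singleton] at key
  obtain ⟨p, _, ⟨q, _, ⟨r, _, ⟨s, rfl⟩, rfl⟩, rfl⟩, rfl⟩ := key
  exact ⟨p, q, r, s, by simp only [smul_eq_mul]; abel⟩

theorem exact_augmentation (h : IsResolvingTuple a b u c) :
    Function.Exact (rowMap (boundaryMatrix (of ℤ G a) (of ℤ G b) (of ℤ G u) (of ℤ G c) 0))
      (resolutionAugmentation G) := by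
  intro x
  constructor
  · intro hx
    obtain ⟨p, q, r, s, hs⟩ := h.exists_of_augmentation_eq_zero hx
    let y : Fin 4 → MonoidAlgebra ℤ G := ![p, q, r, s]
    refine ⟨Finsupp.equivFunOnFinite.symm y, ?_⟩
    ext1 j
    rw [rowMap_apply]
    change ∑ i : Fin 4, y i * _ = _
    rw [Fin.sum_univ_four]
    obtain rfl : j = ⟨0, Nat.one_pos⟩ := Subsingleton.elim (α := Fin 1) _ _
    exact hs
  · rintro ⟨y, rfl⟩
    rw [resolutionAugmentation_apply, rowMap_apply]
    change augmentation G (∑ i : Fin 4, _) = 0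
    rw [Fin.sum_univ_four]
    generalize hy : (fun i : Fin 4 => y i) = z
    change augmentation G ((fun i : Fin 4 => y i) 0 * (of ℤ G a - 1) +
      (fun i : Fin 4 => y i) 1 * (of ℤ G b - 1) + (fun i : Fin 4 => y i) 2 * (of ℤ G u - 1) +
      (fun i : Fin 4 => y i) 3 * (of ℤ G c - 1)) = 0
    rw [hy]
    simp [MonoidAlgebra.one_def]

theorem nonempty_groupHomology_addEquiv (h : IsResolvingTuple a b u c) (n : ℕ) :
    Nonempty (GroupHomology ℤ G ℤ (n + 1) ≃+
      MiddleHomology (rowMap (boundaryMatrix (1 : ℤ) 1 1 1 (n + 1)))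
        (rowMap (boundaryMatrix (1 : ℤ) 1 1 1 n))) := by
  refine nonempty_groupHomology_addEquiv_of_resolution (ι := fun n => Fin (resolutionRank n))
    (fun n => rowMap (boundaryMatrix (of ℤ G a) (of ℤ G b) (of ℤ G u) (of ℤ G c) n))
    h.exact_rowMap (resolutionAugmentation G) ?_ h.exact_augmentation ?_
    (fun n => rowMap (boundaryMatrix (1 : ℤ) 1 1 1 n)) ?_ n
  · intro g x
    simp [resolutionAugmentation_apply]
  · intro k
    refine ⟨Finsupp.single ⟨0, Nat.one_pos⟩ (MonoidAlgebra.single 1 k), ?_⟩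
    simp [resolutionAugmentation_apply]
  · intro n x
    ext j
    have e : ∀ g, (augmentation G).toRingHom (of ℤ G g) = 1 := fun g => by simp
    simp only [rowMap_apply, finsuppAugmentation, Finsupp.mapRange.linearMap_apply,
      Finsupp.mapRange_apply]
    change _ = (augmentation G).toRingHom _
    rw [map_sum]
    refine Finset.sum_congr rfl fun i _ => ?_
    rw [map_mul, boundaryMatrix_map, e, e, e, e]
    rfl

end IsResolvingTuple

section MiddleHomology

theorem nonempty_middleHomology_addEquiv {L M N T : Type} [AddCommGroup L] [AddCommGroup M]
    [AddCommGroup N] [AddCommGroup T] (f : L →ₗ[ℤ] M) (g : M →ₗ[ℤ] N) (φ : M → T)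
    (hadd : ∀ x y, φ (x + y) = φ x + φ y) (hsurj : ∀ t, ∃ x, g x = 0 ∧ φ x = t)
    (hker : ∀ x, g x = 0 → (φ x = 0 ↔ ∃ y, f y = x)) :
    Nonempty (MiddleHomology f g ≃+ T) := by
  let ψ : LinearMap.ker g →ₗ[ℤ] T :=
    (AddMonoidHom.mk' φ hadd).toIntLinearMap ∘ₗ (LinearMap.ker g).subtype
  have hψ : Function.Surjective ψ := fun t => by
    obtain ⟨x, hx, rfl⟩ := hsurj t
    exact ⟨⟨x, hx⟩, rfl⟩
  have hk : (LinearMap.range f).comap (LinearMap.ker g).subtype = LinearMap.ker ψ := by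
    ext ⟨x, hx⟩
    exact (hker x hx).symm
  exact ⟨((Submodule.quotEquivOfEq _ _ hk).trans
    (ψ.quotKerEquivOfSurjective hψ)).toAddEquiv⟩

theorem middleHomology_boundaryMatrix_zero :
    Nonempty (MiddleHomology (rowMap (boundaryMatrix (1 : ℤ) 1 1 1 1))
      (rowMap (boundaryMatrix (1 : ℤ) 1 1 1 0)) ≃+ ((Fin 2 → ℤ) × ZMod 3 × ZMod 2)) := by
  let D : Matrix (Fin 5) (Fin 4) ℤ := boundaryMatrix (1 : ℤ) 1 1 1 1
  let E : Matrix (Fin 4) (Fin 1) ℤ := boundaryMatrix (1 : ℤ) 1 1 1 0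
  change Nonempty (MiddleHomology (rowMap D) (rowMap E) ≃+ _)
  refine nonempty_middleHomology_addEquiv _ _
    (fun x => (![x 2, x 3], ((x 1 : ℤ) : ZMod 3), ((x 0 : ℤ) : ZMod 2))) ?_ ?_ ?_
  · intro x y
    simp
  · rintro ⟨t, p, q⟩
    refine ⟨Finsupp.equivFunOnFinite.symm ![q.val, p.val, t 0, t 1], ?_, ?_⟩
    · rw [rowMap_eq_zero_iff]
      intro j
      fin_cases j
      simp [E, boundaryMatrix, Fin.sum_univ_four]
    · simp
      ext i
      fin_cases i <;> rfl
  · intro x hx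
    rw [rowMap_eq_zero_iff] at hx
    simp [E, boundaryMatrix, Fin.sum_univ_four] at hx
    simp [ZMod.intCast_zmod_eq_zero_iff_dvd]
    constructor
    · intro h
      refine ⟨Finsupp.equivFunOnFinite.symm ![x 0 / 2, x 1 / 3, 0, 0, 0], ?_⟩
      ext j
      rw [rowMap_apply]
      fin_cases j <;> simp [D, boundaryMatrix, Fin.sum_univ_five] <;> omega
    · rintro ⟨y, rfl⟩
      simp [rowMap_apply, D, boundaryMatrix, Fin.sum_univ_five]

theorem middleHomology_boundaryMatrix_one :
    Nonempty (MiddleHomology (rowMap (boundaryMatrix (1 : ℤ) 1 1 1 2))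
      (rowMap (boundaryMatrix (1 : ℤ) 1 1 1 1)) ≃+ (ℤ × ZMod 3 × ZMod 2)) := by
  let D : Matrix (Fin 4) (Fin 5) ℤ := boundaryMatrix (1 : ℤ) 1 1 1 2
  let E : Matrix (Fin 5) (Fin 4) ℤ := boundaryMatrix (1 : ℤ) 1 1 1 1
  change Nonempty (MiddleHomology (rowMap D) (rowMap E) ≃+ _)
  refine nonempty_middleHomology_addEquiv _ _
    (fun x => (x 2, ((x 4 : ℤ) : ZMod 3), ((x 3 : ℤ) : ZMod 2))) ?_ ?_ ?_
  · intro x y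
    simp
  · rintro ⟨t, p, q⟩
    refine ⟨Finsupp.equivFunOnFinite.symm ![0, 0, t, q.val, p.val], ?_, ?_⟩
    · rw [rowMap_eq_zero_iff]
      intro j
      fin_cases j <;> simp [E, boundaryMatrix, Fin.sum_univ_five]
    · simp
  · intro x hx
    rw [rowMap_eq_zero_iff] at hx
    simp [E, boundaryMatrix, Fin.sum_univ_five, Fin.forall_fin_succ] at hx
    simp [ZMod.intCast_zmod_eq_zero_iff_dvd]
    constructor
    · intro h
      refine ⟨Finsupp.equivFunOnFinite.symm ![0, 0, x 3 / 2, x 4 / 3], ?_⟩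
      ext j
      rw [rowMap_apply]
      fin_cases j <;> simp [D, boundaryMatrix, Fin.sum_univ_four] <;> omega
    · rintro ⟨y, rfl⟩
      simp [rowMap_apply, D, boundaryMatrix, Fin.sum_univ_four]

theorem middleHomology_boundaryMatrix_two :
    Nonempty (MiddleHomology (rowMap (boundaryMatrix (1 : ℤ) 1 1 1 3))
      (rowMap (boundaryMatrix (1 : ℤ) 1 1 1 2)) ≃+ (ZMod 3 × ZMod 2)) := by
  let D : Matrix (Fin 4) (Fin 4) ℤ := boundaryMatrix (1 : ℤ) 1 1 1 3
  let E : Matrix (Fin 4) (Fin 5) ℤ := boundaryMatrix (1 : ℤ) 1 1 1 2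
  change Nonempty (MiddleHomology (rowMap D) (rowMap E) ≃+ _)
  refine nonempty_middleHomology_addEquiv _ _
    (fun x => (((x 1 : ℤ) : ZMod 3), ((x 0 : ℤ) : ZMod 2))) ?_ ?_ ?_
  · intro x y
    simp
  · rintro ⟨p, q⟩
    refine ⟨Finsupp.equivFunOnFinite.symm ![q.val, p.val, 0, 0], ?_, ?_⟩
    · rw [rowMap_eq_zero_iff]
      intro j
      fin_cases j <;> simp [E, boundaryMatrix, Fin.sum_univ_four]
    · simp
  · intro x hx
    rw [rowMap_eq_zero_iff] at hx
    simp [E, boundaryMatrix, Fin.sum_univ_four, Fin.forall_fin_succ] at hx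
    simp [ZMod.intCast_zmod_eq_zero_iff_dvd]
    constructor
    · intro h
      refine ⟨Finsupp.equivFunOnFinite.symm ![x 0 / 2, x 1 / 3, 0, 0], ?_⟩
      ext j
      rw [rowMap_apply]
      fin_cases j <;> simp [D, boundaryMatrix, Fin.sum_univ_four] <;> omega
    · rintro ⟨y, rfl⟩
      simp [rowMap_apply, D, boundaryMatrix, Fin.sum_univ_four]

theorem middleHomology_boundaryMatrix_three :
    Nonempty (MiddleHomology (rowMap (boundaryMatrix (1 : ℤ) 1 1 1 4))
      (rowMap (boundaryMatrix (1 : ℤ) 1 1 1 3)) ≃+ (ZMod 3 × ZMod 2)) := by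
  let D : Matrix (Fin 4) (Fin 4) ℤ := boundaryMatrix (1 : ℤ) 1 1 1 4
  let E : Matrix (Fin 4) (Fin 4) ℤ := boundaryMatrix (1 : ℤ) 1 1 1 3
  change Nonempty (MiddleHomology (rowMap D) (rowMap E) ≃+ _)
  refine nonempty_middleHomology_addEquiv _ _
    (fun x => (((x 3 : ℤ) : ZMod 3), ((x 2 : ℤ) : ZMod 2))) ?_ ?_ ?_
  · intro x y
    simp
  · rintro ⟨p, q⟩
    refine ⟨Finsupp.equivFunOnFinite.symm ![0, 0, q.val, p.val], ?_, ?_⟩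
    · rw [rowMap_eq_zero_iff]
      intro j
      fin_cases j <;> simp [E, boundaryMatrix, Fin.sum_univ_four]
    · simp
  · intro x hx
    rw [rowMap_eq_zero_iff] at hx
    simp [E, boundaryMatrix, Fin.sum_univ_four, Fin.forall_fin_succ] at hx
    simp [ZMod.intCast_zmod_eq_zero_iff_dvd]
    constructor
    · intro h
      refine ⟨Finsupp.equivFunOnFinite.symm ![0, 0, x 2 / 2, x 3 / 3], ?_⟩
      ext j
      rw [rowMap_apply]
      fin_cases j <;> simp [D, boundaryMatrix, Fin.sum_univ_four] <;> omega
    · rintro ⟨y, rfl⟩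
      simp [rowMap_apply, D, boundaryMatrix, Fin.sum_univ_four]

theorem middleHomology_boundaryMatrix_four :
    Nonempty (MiddleHomology (rowMap (boundaryMatrix (1 : ℤ) 1 1 1 5))
      (rowMap (boundaryMatrix (1 : ℤ) 1 1 1 4)) ≃+ (ZMod 3 × ZMod 2)) := by
  let D : Matrix (Fin 4) (Fin 4) ℤ := boundaryMatrix (1 : ℤ) 1 1 1 5
  let E : Matrix (Fin 4) (Fin 4) ℤ := boundaryMatrix (1 : ℤ) 1 1 1 4
  change Nonempty (MiddleHomology (rowMap D) (rowMap E) ≃+ _)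
  refine nonempty_middleHomology_addEquiv _ _
    (fun x => (((x 1 : ℤ) : ZMod 3), ((x 0 : ℤ) : ZMod 2))) ?_ ?_ ?_
  · intro x y
    simp
  · rintro ⟨p, q⟩
    refine ⟨Finsupp.equivFunOnFinite.symm ![q.val, p.val, 0, 0], ?_, ?_⟩
    · rw [rowMap_eq_zero_iff]
      intro j
      fin_cases j <;> simp [E, boundaryMatrix, Fin.sum_univ_four]
    · simp
  · intro x hx
    rw [rowMap_eq_zero_iff] at hx
    simp [E, boundaryMatrix, Fin.sum_univ_four, Fin.forall_fin_succ] at hx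
    simp [ZMod.intCast_zmod_eq_zero_iff_dvd]
    constructor
    · intro h
      refine ⟨Finsupp.equivFunOnFinite.symm ![x 0 / 2, x 1 / 3, 0, 0], ?_⟩
      ext j
      rw [rowMap_apply]
      fin_cases j <;> simp [D, boundaryMatrix, Fin.sum_univ_four] <;> omega
    · rintro ⟨y, rfl⟩
      simp [rowMap_apply, D, boundaryMatrix, Fin.sum_univ_four]

theorem middleHomology_boundaryMatrix_add_two (n : ℕ) :
    Nonempty (MiddleHomology (rowMap (boundaryMatrix (1 : ℤ) 1 1 1 (n + 3)))
      (rowMap (boundaryMatrix (1 : ℤ) 1 1 1 (n + 2))) ≃+ (ZMod 3 × ZMod 2)) := by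
  induction n using Nat.strong_induction_on with
  | _ n ih =>
    match n with
    | 0 => exact middleHomology_boundaryMatrix_two
    | 1 => exact middleHomology_boundaryMatrix_three
    | 2 => exact middleHomology_boundaryMatrix_four
    | n + 3 => exact ih (n + 1) (by omega)

end MiddleHomology

theorem IsResolvingTuple.homology {G : Type} [Group G] {a b u c : G}
    (h : IsResolvingTuple a b u c) (q : ℕ) (hq : 1 ≤ q) :
    (q = 1 → Nonempty (GroupHomology ℤ G ℤ q ≃+ ((Fin 2 → ℤ) × ZMod 3 × ZMod 2))) ∧
      (q = 2 → Nonempty (GroupHomology ℤ G ℤ q ≃+ (ℤ × ZMod 3 × ZMod 2))) ∧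
      (3 ≤ q → Nonempty (GroupHomology ℤ G ℤ q ≃+ (ZMod 3 × ZMod 2))) := by
  obtain ⟨n, rfl⟩ : ∃ n, q = n + 1 := ⟨q - 1, by omega⟩
  obtain ⟨e⟩ := h.nonempty_groupHomology_addEquiv n
  refine ⟨fun hn => ?_, fun hn => ?_, fun hn => ?_⟩
  · obtain rfl : n = 0 := by omega
    exact middleHomology_boundaryMatrix_zero.map e.trans
  · obtain rfl : n = 1 := by omega
    exact middleHomology_boundaryMatrix_one.map e.trans
  · obtain ⟨m, rfl⟩ : ∃ m, n = m + 2 := ⟨n - 2, by omega⟩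
    exact (middleHomology_boundaryMatrix_add_two m).map e.trans

/-! ### Hermitian forms over the ring of integers of discriminant `-15`

An element `x + y ω` of the ring, with `ω² = ω - 4`, is handled through its integral
coordinates. -/

section IntegerLemmas

/-- The values at the two basis vectors of a Hermitian form of determinant one whose trace is
`±8` modulo `15` have the same sign. -/
theorem mul_pos_of_discriminant {A D T y k : ℤ} (h : T ^ 2 + 15 * y ^ 2 = 4 + 60 * (A * D))
    (hk : k ^ 2 = 16) (hT : T ≡ 2 * k [ZMOD 15]) : 0 < A * D := by
  have hk' : k = 4 ∨ k = -4 := by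
    rw [show (16 : ℤ) = 4 ^ 2 by norm_num, sq_eq_sq_iff_eq_or_eq_neg] at hk
    exact hk
  by_contra! h0
  have h1 : A * D = 0 := by nlinarith [sq_nonneg T, sq_nonneg y]
  have h2 : T ^ 2 ≤ 4 := by nlinarith [sq_nonneg y]
  have h3 : -2 ≤ T := by nlinarith
  have h4 : T ≤ 2 := by nlinarith
  unfold Int.ModEq at hT
  rcases hk' with rfl | rfl <;> omega

theorem eq_of_pos_of_neg {A D T y : ℤ} (h : T ^ 2 + 15 * y ^ 2 = 4 + 60 * (A * D))
    (hA : 0 < A) (hD : 0 < D) (h' : 16 * A + 15 * D + 4 * T < 0) :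
    A = 1 ∧ D = 1 ∧ T = -8 ∧ y = 0 := by
  have h1 : (16 * A - 15 * D) ^ 2 + 2 * (16 * A + 15 * D) ≤ 63 := by
    nlinarith [sq_nonneg y]
  have h2 : A = 1 := by nlinarith [sq_nonneg (16 * A - 15 * D)]
  have h3 : D = 1 := by nlinarith [sq_nonneg (16 * A - 15 * D)]
  subst h2 h3
  have h4 : T ≤ -8 := by omega
  have h5 : T = -8 := by nlinarith [sq_nonneg y]
  subst h5
  refine ⟨rfl, rfl, rfl, ?_⟩
  nlinarith

/-- The sign of the value of a Hermitian form at the first basis vector changes under the matrix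
`c` only for the form fixed at the beginning. -/
theorem sign_change_iff {A D T y : ℤ} (h : T ^ 2 + 15 * y ^ 2 = 4 + 60 * (A * D))
    (hT : T ≡ -8 [ZMOD 15]) (h0 : 16 * A + 15 * D + 4 * T ≠ 0) :
    ((if 16 * A + 15 * D + 4 * T < 0 then 1 else 0) - (if A < 0 then 1 else 0) : ℤ) =
      if A = 1 ∧ D = 1 ∧ T = -8 ∧ y = 0 then 1 else 0 := by
  have hpos := mul_pos_of_discriminant h (k := -4) (by norm_num) (by simpa using hT)
  unfold Int.ModEq at hT
  rcases mul_pos_iff.1 hpos with ⟨hA, hD⟩ | ⟨hA, hD⟩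
  · by_cases h' : 16 * A + 15 * D + 4 * T < 0
    · rw [if_pos h', if_neg (by omega), if_pos (eq_of_pos_of_neg h hA hD h')]
      norm_num
    · rw [if_neg h', if_neg (by omega), if_neg (by omega)]
      norm_num
  · have h' : 16 * A + 15 * D + 4 * T < 0 := by
      by_contra h'
      have := eq_of_pos_of_neg (A := -A) (D := -D) (T := -T) (y := y) (by linarith [h])
        (by omega) (by omega) (by omega)
      omega
    rw [if_pos h', if_pos hA, if_neg (by omega)]
    norm_num

variable {p₁ p₂ q₁ q₂ r₁ r₂ s₁ s₂ : ℤ}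

theorem hermitian_discriminant (h₁ : p₁ * s₁ - 4 * p₂ * s₂ - q₁ * r₁ + 4 * q₂ * r₂ = 1)
    (h₂ : p₁ * s₂ + p₂ * s₁ + p₂ * s₂ - q₁ * r₂ - q₂ * r₁ - q₂ * r₂ = 0) {k : ℤ}
    (hk : k ^ 2 = 16) :
    (k * (2 * p₁ * s₁ + p₁ * s₂ + p₂ * s₁ + 8 * p₂ * s₂ -
      2 * q₁ * r₁ - q₁ * r₂ - q₂ * r₁ - 8 * q₂ * r₂) -
      15 * (p₁ * q₂ - p₂ * q₁ + r₁ * s₂ - r₂ * s₁)) ^ 2 +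
    15 * (2 * p₁ * q₁ + p₁ * q₂ + p₂ * q₁ + 8 * p₂ * q₂ +
      2 * r₁ * s₁ + r₁ * s₂ + r₂ * s₁ + 8 * r₂ * s₂ +
      k * (p₁ * s₂ - p₂ * s₁ - r₁ * q₂ + r₂ * q₁)) ^ 2 =
    4 + 60 * ((p₁ ^ 2 + p₁ * p₂ + 4 * p₂ ^ 2 + (r₁ ^ 2 + r₁ * r₂ + 4 * r₂ ^ 2) +
        k * (p₁ * r₂ - p₂ * r₁)) *
      (q₁ ^ 2 + q₁ * q₂ + 4 * q₂ ^ 2 + (s₁ ^ 2 + s₁ * s₂ + 4 * s₂ ^ 2) +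
        k * (q₁ * s₂ - q₂ * s₁))) := by
  linear_combination 4 * (k ^ 2 - 15) *
    ((p₁ * s₁ - 4 * p₂ * s₂ - q₁ * r₁ + 4 * q₂ * r₂ + 1) * h₁ +
      (p₁ * s₁ - 4 * p₂ * s₂ - q₁ * r₁ + 4 * q₂ * r₂ +
        4 * (p₁ * s₂ + p₂ * s₁ + p₂ * s₂ - q₁ * r₂ - q₂ * r₁ - q₂ * r₂)) * h₂) + 4 * hk

end IntegerLemmas

/-- The ring of integers of discriminant `-15`, as the ring of all `x + y ω` with
`ω² = ω - 4`. -/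
abbrev O15 : Type := QuadraticAlgebra ℤ (-4) 1

/-- The special linear group of degree two over `O15`. -/
abbrev SL2O : Type := Matrix.SpecialLinearGroup (Fin 2) O15

namespace SL2O

open QuadraticAlgebra Matrix

/-- The elliptic element of order four. -/
def a : SL2O := ⟨!![0, -1; 1, 0], by simp⟩

/-- The translation by `1`. -/
def t : SL2O := ⟨!![1, 1; 0, 1], by simp⟩

/-- The elliptic element of order six. -/
def b : SL2O := ⟨!![0, -1; 1, 1], by simp⟩

/-- The translation by `ω`. -/
def u : SL2O := ⟨!![1, ⟨0, 1⟩; 0, 1], by simp⟩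

/-- The generator centralizing `a`, built from `θ = 2 ω - 1` with `θ² = -15`. -/
def c : SL2O := ⟨!![4, ⟨1, -2⟩; ⟨-1, 2⟩, 4], by
  ext <;> simp [Matrix.det_fin_two]⟩

theorem det_re (g : SL2O) : (g 0 0).re * (g 1 1).re - 4 * (g 0 0).im * (g 1 1).im -
    (g 0 1).re * (g 1 0).re + 4 * (g 0 1).im * (g 1 0).im = 1 := by
  have := congrArg QuadraticAlgebra.re g.det_coe
  rw [Matrix.det_fin_two] at this
  simp at this
  linarith

theorem det_im (g : SL2O) : (g 0 0).re * (g 1 1).im + (g 0 0).im * (g 1 1).re +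
    (g 0 0).im * (g 1 1).im - (g 0 1).re * (g 1 0).im - (g 0 1).im * (g 1 0).re -
    (g 0 1).im * (g 1 0).im = 0 := by
  have := congrArg QuadraticAlgebra.im g.det_coe
  rw [Matrix.det_fin_two] at this
  simp at this
  linarith

/-- The value at the `j`-th column of `g` of the Hermitian form with matrix
`(1, k; -k, 1)`. -/
def hermVal (k : ℤ) (g : SL2O) (j : Fin 2) : ℤ :=
  (g 0 j).re ^ 2 + (g 0 j).re * (g 0 j).im + 4 * (g 0 j).im ^ 2 +
    ((g 1 j).re ^ 2 + (g 1 j).re * (g 1 j).im + 4 * (g 1 j).im ^ 2) +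
    k * ((g 0 j).re * (g 1 j).im - (g 0 j).im * (g 1 j).re)

/-- The trace of the off-diagonal coefficient of the transformed Hermitian form. -/
def hermTrace (k : ℤ) (g : SL2O) : ℤ :=
  k * (2 * (g 0 0).re * (g 1 1).re + (g 0 0).re * (g 1 1).im + (g 0 0).im * (g 1 1).re +
    8 * (g 0 0).im * (g 1 1).im - 2 * (g 0 1).re * (g 1 0).re - (g 0 1).re * (g 1 0).im -
    (g 0 1).im * (g 1 0).re - 8 * (g 0 1).im * (g 1 0).im) -
  15 * ((g 0 0).re * (g 0 1).im - (g 0 0).im * (g 0 1).re + (g 1 0).re * (g 1 1).im -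
    (g 1 0).im * (g 1 1).re)

/-- The second coordinate of the off-diagonal coefficient of the transformed Hermitian form. -/
def hermIm (k : ℤ) (g : SL2O) : ℤ :=
  2 * (g 0 0).re * (g 0 1).re + (g 0 0).re * (g 0 1).im + (g 0 0).im * (g 0 1).re +
    8 * (g 0 0).im * (g 0 1).im + 2 * (g 1 0).re * (g 1 1).re + (g 1 0).re * (g 1 1).im +
    (g 1 0).im * (g 1 1).re + 8 * (g 1 0).im * (g 1 1).im +
    k * ((g 0 0).re * (g 1 1).im - (g 0 0).im * (g 1 1).re - (g 1 0).re * (g 0 1).im +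
      (g 1 0).im * (g 0 1).re)

theorem herm_discriminant {k : ℤ} (hk : k ^ 2 = 16) (g : SL2O) :
    hermTrace k g ^ 2 + 15 * hermIm k g ^ 2 = 4 + 60 * (hermVal k g 0 * hermVal k g 1) :=
  hermitian_discriminant g.det_re g.det_im hk

theorem hermTrace_modEq (k : ℤ) (g : SL2O) : hermTrace k g ≡ 2 * k [ZMOD 15] := by
  rw [Int.modEq_comm, Int.modEq_iff_dvd]
  refine ⟨k * ((g 0 0).im * (g 1 1).im - (g 0 1).im * (g 1 0).im) -
    ((g 0 0).re * (g 0 1).im - (g 0 0).im * (g 0 1).re + (g 1 0).re * (g 1 1).im -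
    (g 1 0).im * (g 1 1).re), ?_⟩
  unfold hermTrace
  linear_combination 2 * k * g.det_re + k * g.det_im

theorem hermVal_mul_pos {k : ℤ} (hk : k ^ 2 = 16) (g : SL2O) :
    0 < hermVal k g 0 * hermVal k g 1 :=
  mul_pos_of_discriminant (herm_discriminant hk g) hk (hermTrace_modEq k g)

theorem hermVal_ne_zero {k : ℤ} (hk : k ^ 2 = 16) (g : SL2O) : hermVal k g 0 ≠ 0 :=
  left_ne_zero_of_mul (hermVal_mul_pos hk g).ne'

theorem mul_apply (g h : SL2O) (i j : Fin 2) : (g * h) i j = g i 0 * h 0 j + g i 1 * h 1 j := by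
  rw [Matrix.SpecialLinearGroup.coe_mul, Matrix.mul_apply, Fin.sum_univ_two]

theorem ext_entries {g h : SL2O} (h₀₀ : g 0 0 = h 0 0) (h₀₁ : g 0 1 = h 0 1)
    (h₁₀ : g 1 0 = h 1 0) (h₁₁ : g 1 1 = h 1 1) : g = h := by
  refine Matrix.SpecialLinearGroup.ext _ _ fun i j => ?_
  fin_cases i <;> fin_cases j <;> assumption

theorem mul_a_apply (g : SL2O) (i : Fin 2) : (g * a) i 0 = g i 1 ∧ (g * a) i 1 = -g i 0 := by
  simp only [mul_apply]
  simp [a]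

theorem mul_t_apply (g : SL2O) (i : Fin 2) :
    (g * t) i 0 = g i 0 ∧ (g * t) i 1 = g i 0 + g i 1 := by
  simp only [mul_apply]
  simp [t]

theorem mul_u_apply (g : SL2O) (i : Fin 2) :
    (g * u) i 0 = g i 0 ∧ (g * u) i 1 = g i 0 * ⟨0, 1⟩ + g i 1 := by
  simp only [mul_apply]
  simp [u]

theorem mul_c_apply (g : SL2O) (i : Fin 2) : (g * c) i 0 = g i 0 * 4 + g i 1 * ⟨-1, 2⟩ := by
  simp only [mul_apply]
  simp [c]

theorem b_eq : b = a * t := by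
  apply ext_entries <;> simp only [mul_apply] <;> simp [a, t, b]

theorem hermVal_mul_a (k : ℤ) (g : SL2O) : hermVal k (g * a) 0 = hermVal k g 1 := by
  simp only [hermVal, mul_a_apply]

theorem hermVal_mul_t (k : ℤ) (g : SL2O) : hermVal k (g * t) 0 = hermVal k g 0 := by
  simp only [hermVal, mul_t_apply]

theorem hermVal_mul_u (k : ℤ) (g : SL2O) : hermVal k (g * u) 0 = hermVal k g 0 := by
  simp only [hermVal, mul_u_apply]

theorem hermVal_mul_c (k : ℤ) (g : SL2O) :
    hermVal k (g * c) 0 = 16 * hermVal k g 0 + 15 * hermVal k g 1 + 4 * hermTrace k g := by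
  simp only [hermVal, hermTrace, mul_c_apply]
  simp
  ring

end SL2O

/-! ### The projective group and the edge group of the stable letter `c` -/

namespace SL2O

open QuadraticAlgebra Matrix ModularGroup
open scoped MatrixGroups

/-- The projection of the special linear group to the projective special linear group. -/
def proj : SL2O →* PSL2 O15 := QuotientGroup.mk' _

theorem proj_surjective : Function.Surjective proj := QuotientGroup.mk'_surjective _

theorem neg_apply (g : SL2O) (i j : Fin 2) : (-g) i j = -g i j := by
  rw [Matrix.SpecialLinearGroup.coe_neg, Matrix.neg_apply]

theorem eq_one_or_eq_neg_one_of_sq {r : O15} (h : r ^ 2 = 1) : r = 1 ∨ r = -1 := by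
  have h₁ := congrArg QuadraticAlgebra.re h
  have h₂ := congrArg QuadraticAlgebra.im h
  simp only [sq, re_mul, im_mul, re_one, im_one] at h₁ h₂
  have h₃ : r.im * (2 * r.re + r.im) = 0 := by linarith
  rcases mul_eq_zero.1 h₃ with h₄ | h₄
  · rw [h₄] at h₁
    have h₅ : r.re * r.re = 1 := by linarith
    rcases mul_self_eq_one_iff.1 h₅ with h | h
    · left
      ext <;> simp [h, h₄]
    · right
      ext <;> simp [h, h₄]
  · have : r.im = -(2 * r.re) := by linarith
    rw [this] at h₁
    nlinarith

theorem proj_eq_one_iff {g : SL2O} : proj g = 1 ↔ g = 1 ∨ g = -1 := by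
  unfold proj
  rw [QuotientGroup.mk'_apply, QuotientGroup.eq_one_iff, Matrix.SpecialLinearGroup.mem_center_iff]
  constructor
  · rintro ⟨r, hr, h⟩
    have hs : ∀ i j, g i j = Matrix.scalar (Fin 2) r i j := fun i j => by rw [h]
    rcases eq_one_or_eq_neg_one_of_sq (by simpa using hr) with rfl | rfl
    · left
      apply ext_entries <;> simp [hs]
    · right
      apply ext_entries <;> simp [hs, neg_apply]
  · rintro (rfl | rfl)
    · exact ⟨1, by simp, by simp⟩
    · refine ⟨-1, by simp, ?_⟩
      ext1 i j
      rw [Matrix.SpecialLinearGroup.coe_neg]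
      fin_cases i <;> fin_cases j <;> simp

theorem proj_eq_proj_iff {g h : SL2O} : proj g = proj h ↔ g = h ∨ g = -h := by
  rw [← mul_inv_eq_one, ← map_inv, ← map_mul, proj_eq_one_iff, mul_inv_eq_one,
    mul_inv_eq_iff_eq_mul,
    neg_one_mul]

theorem proj_neg (g : SL2O) : proj (-g) = proj g := proj_eq_proj_iff.2 (Or.inr rfl)

/-- An even function on the special linear group, as a function on the projective group. -/
noncomputable def descend (Φ : SL2O → ℤ) (x : PSL2 O15) : ℤ :=
  Φ (proj_surjective x).choose

theorem descend_proj {Φ : SL2O → ℤ} (hΦ : ∀ g, Φ (-g) = Φ g) (g : SL2O) :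
    descend Φ (proj g) = Φ g := by
  unfold descend
  rcases proj_eq_proj_iff.1 (proj_surjective (proj g)).choose_spec with h | h
  · rw [h]
  · rw [h, hΦ]

/-- The second vertex element of order six, conjugate to `b`. -/
def b' : SL2O := ⟨!![⟨1, -1⟩, 3; 1, ⟨0, 1⟩], by ext <;> simp [Matrix.det_fin_two]⟩

theorem b'_eq : b' = (a * u)⁻¹ * b * (a * u) := by
  rw [mul_assoc, eq_inv_mul_iff_mul_eq]
  apply ext_entries <;> simp only [mul_apply] <;> ext <;> simp [a, u, b, b']

/-- The matrix with rows `(p, q)` and `(r, s)`. -/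
def ofEntries (p q r s : O15) (h : p * s - q * r = 1) : SL2O :=
  ⟨!![p, q; r, s], by rw [Matrix.det_fin_two_of, h]⟩

section OfEntries

variable {p q r s : O15} (h : p * s - q * r = 1)

@[simp] theorem ofEntries_zero_zero : ofEntries p q r s h 0 0 = p := rfl

@[simp] theorem ofEntries_zero_one : ofEntries p q r s h 0 1 = q := rfl

@[simp] theorem ofEntries_one_zero : ofEntries p q r s h 1 0 = r := rfl

@[simp] theorem ofEntries_one_one : ofEntries p q r s h 1 1 = s := rfl

end OfEntries

theorem int_det (A : SL(2, ℤ)) : A 0 0 * A 1 1 - A 0 1 * A 1 0 = 1 := by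
  have h := A.det_coe
  rwa [Matrix.det_fin_two] at h

theorem int_mul_apply (A B : SL(2, ℤ)) (i j : Fin 2) :
    (A * B) i j = A i 0 * B 0 j + A i 1 * B 1 j := by
  rw [Matrix.SpecialLinearGroup.coe_mul, Matrix.mul_apply, Fin.sum_univ_two]

/-- The matrix corresponding to an integral matrix under `modularEmbedding`. -/
def modularFun (A : SL(2, ℤ)) : SL2O :=
  ofEntries ⟨-2 * A 0 1 - 2 * A 1 0 + A 1 1, A 0 0 - A 1 1⟩
    ⟨-2 * A 0 0 + A 1 0 + 2 * A 1 1, -A 0 1 - A 1 0⟩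
    ⟨-2 * A 0 0 + A 0 1 + 2 * A 1 1, -A 0 1 - A 1 0⟩
    ⟨A 0 0 + 2 * A 0 1 + 2 * A 1 0, -A 0 0 + A 1 1⟩ (by
    ext
    · simp only [re_sub, re_mul, re_one]
      linear_combination int_det A
    · simp only [im_sub, im_mul, im_one]
      ring)

theorem modularFun_mul (A B : SL(2, ℤ)) : modularFun (A * B) = modularFun A * modularFun B := by
  apply ext_entries <;> rw [mul_apply] <;> ext <;>
    simp only [modularFun, ofEntries_zero_zero, ofEntries_zero_one, ofEntries_one_zero,
      ofEntries_one_one, int_mul_apply, re_add, im_add, re_mul, im_mul] <;> ring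

/-- The embedding of the modular group whose image is generated by `a` and `b'`. -/
def modularEmbedding : SL(2, ℤ) →* SL2O where
  toFun := modularFun
  map_one' := by
    apply ext_entries <;> ext <;> simp [modularFun]
  map_mul' := modularFun_mul

theorem modularEmbedding_S : modularEmbedding S = -a := by
  apply ext_entries <;> rw [neg_apply] <;> ext <;>
    simp [modularEmbedding, modularFun, S, a]

theorem modularEmbedding_S_mul_T : modularEmbedding (S * T) = b' := by
  change modularFun (S * T) = b'
  apply ext_entries <;> ext <;> simp only [modularFun, ofEntries_zero_zero, ofEntries_zero_one,
    ofEntries_one_zero, ofEntries_one_one, int_mul_apply] <;> simp [S, T, b']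

theorem closure_proj_eq_range :
    Subgroup.closure {proj a, proj b'} = (proj.comp modularEmbedding).range := by
  have hS : (proj.comp modularEmbedding) S = proj a := by
    rw [MonoidHom.comp_apply, modularEmbedding_S, proj_neg]
  have hST : (proj.comp modularEmbedding) (S * T) = proj b' := by
    rw [MonoidHom.comp_apply, modularEmbedding_S_mul_T]
  apply le_antisymm
  · rw [Subgroup.closure_le]
    rintro x (rfl | rfl)
    · exact ⟨S, hS⟩
    · exact ⟨S * T, hST⟩
  · rw [MonoidHom.range_eq_map, ← SpecialLinearGroup.SL2Z_generators, MonoidHom.map_closure,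
      Subgroup.closure_le]
    have ha : proj a ∈ Subgroup.closure {proj a, proj b'} :=
      Subgroup.subset_closure (Set.mem_insert _ _)
    have hb : proj b' ∈ Subgroup.closure {proj a, proj b'} :=
      Subgroup.subset_closure (Set.mem_insert_of_mem _ rfl)
    rintro _ ⟨x, rfl | rfl, rfl⟩
    · rw [hS]
      exact ha
    · rw [map_mul, hS] at hST
      rw [eq_inv_mul_of_mul_eq hST]
      exact mul_mem (inv_mem ha) hb

/-- A matrix fixes the Hermitian form with matrix `(1, -4; 4, 1)`. -/
def FixesForm (g : SL2O) : Prop :=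
  hermVal (-4) g 0 = 1 ∧ hermVal (-4) g 1 = 1 ∧ hermTrace (-4) g = -8 ∧ hermIm (-4) g = 0

theorem fixesForm_modularEmbedding (A : SL(2, ℤ)) : FixesForm (modularEmbedding A) := by
  have h := int_det A
  change FixesForm (modularFun A)
  unfold FixesForm hermVal hermTrace hermIm
  simp only [modularFun, ofEntries_zero_zero, ofEntries_zero_one, ofEntries_one_zero,
    ofEntries_one_one]
  refine ⟨?_, ?_, ?_, ?_⟩
  · linear_combination h
  · linear_combination h
  · linear_combination -8 * h
  · ring

theorem fixesForm_neg {g : SL2O} : FixesForm (-g) ↔ FixesForm g := by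
  simp only [FixesForm, hermVal, hermTrace, hermIm, neg_apply, re_neg, im_neg, neg_sq,
    mul_neg, neg_mul, neg_neg]

theorem FixesForm.entries {g : SL2O} (h : FixesForm g) :
    (g 0 0).re = (g 1 1).re + (g 1 1).im + 4 * (g 1 0).im ∧ (g 0 0).im = -(g 1 1).im ∧
    (g 0 1).re = -((g 1 0).re + (g 1 0).im) + 4 * (g 1 1).im ∧ (g 0 1).im = (g 1 0).im := by
  obtain ⟨h₁, h₂, h₃, h₄⟩ := h
  have d₁ := g.det_re
  have d₂ := g.det_im
  unfold hermVal at h₁ h₂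
  unfold hermTrace at h₃
  unfold hermIm at h₄
  generalize g 0 0 = p at *
  generalize g 0 1 = q at *
  generalize g 1 0 = r at *
  generalize g 1 1 = s at *
  have d : star s * star p - star r * star q = 1 := by
    ext <;> simp <;> linarith
  have hA : star p * ⟨-1, 2⟩ * p - 4 * star p * r + 4 * star r * p + star r * ⟨-1, 2⟩ * r =
      ⟨-1, 2⟩ := by
    ext <;> simp <;> linarith
  have hD : star q * ⟨-1, 2⟩ * q - 4 * star q * s + 4 * star s * q + star s * ⟨-1, 2⟩ * s =
      ⟨-1, 2⟩ := by
    ext <;> simp <;> linarith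
  have hB : star p * ⟨-1, 2⟩ * q - 4 * star p * s + 4 * star r * q + star r * ⟨-1, 2⟩ * s =
      -4 := by
    ext <;> simp <;> linarith
  have hB' : star q * ⟨-1, 2⟩ * p - 4 * star q * r + 4 * star s * p + star s * ⟨-1, 2⟩ * r =
      4 := by
    ext <;> simp <;> linarith
  have e₁ : (⟨-1, 2⟩ : O15) * p - 4 * r = star s * ⟨-1, 2⟩ - 4 * star r := by
    linear_combination star s * hA - star r * hB' - (⟨-1, 2⟩ * p - 4 * r) * d
  have e₂ : (⟨-1, 2⟩ : O15) * q - 4 * s = -4 * star s - star r * ⟨-1, 2⟩ := by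
    linear_combination star s * hB - star r * hD - (⟨-1, 2⟩ * q - 4 * s) * d
  have f₁ := congrArg QuadraticAlgebra.re e₁
  have f₂ := congrArg QuadraticAlgebra.im e₁
  have f₃ := congrArg QuadraticAlgebra.re e₂
  have f₄ := congrArg QuadraticAlgebra.im e₂
  simp at f₁ f₂ f₃ f₄
  omega

theorem FixesForm.mem_range {g : SL2O} (h : FixesForm g) : g ∈ modularEmbedding.range := by
  obtain ⟨h₁, h₂, h₃, h₄⟩ := h.entries
  have d₁ := g.det_re
  rw [h₁, h₂, h₃, h₄] at d₁
  have hdet : Matrix.det !![(g 1 1).re + 2 * (g 1 0).im, (g 1 0).re - 2 * (g 1 1).im;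
      -(g 1 0).im - (g 1 0).re + 2 * (g 1 1).im, (g 1 1).im + (g 1 1).re + 2 * (g 1 0).im] = 1 := by
    rw [Matrix.det_fin_two_of]
    linear_combination d₁
  refine ⟨⟨_, hdet⟩, ?_⟩
  change modularFun _ = g
  apply ext_entries <;> ext <;> simp [modularFun, h₁, h₂, h₃, h₄] <;> ring

theorem proj_mem_closure_iff (g : SL2O) :
    proj g ∈ Subgroup.closure {proj a, proj b'} ↔ FixesForm g := by
  rw [closure_proj_eq_range]
  constructor
  · rintro ⟨A, hA⟩
    rcases proj_eq_proj_iff.1 hA with h | h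
    · rw [← h]
      exact fixesForm_modularEmbedding A
    · rw [← fixesForm_neg, ← h]
      exact fixesForm_modularEmbedding A
  · intro h
    obtain ⟨A, rfl⟩ := h.mem_range
    exact ⟨A, rfl⟩

theorem hermVal_neg_zero_mul_a {k : ℤ} (hk : k ^ 2 = 16) (g : SL2O) :
    hermVal k (g * a) 0 < 0 ↔ hermVal k g 0 < 0 := by
  rw [hermVal_mul_a]
  exact (neg_iff_neg_of_mul_pos (hermVal_mul_pos hk g)).symm

theorem hermVal_neg (k : ℤ) (g : SL2O) (j : Fin 2) : hermVal k (-g) j = hermVal k g j := by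
  simp only [hermVal, neg_apply, re_neg, im_neg, neg_sq, mul_neg, neg_mul, neg_neg]

open Classical in
theorem exists_separating_c : ∃ Φ : PSL2 O15 → ℤ, (∀ g, Φ (g * proj a) = Φ g) ∧
    (∀ g, Φ (g * proj b) = Φ g) ∧ (∀ g, Φ (g * proj u) = Φ g) ∧
    ∀ g, Φ (g * proj c) - Φ g =
      if g ∈ Subgroup.closure {proj a, (proj a * proj u)⁻¹ * proj b * (proj a * proj u)}
        then 1 else 0 := by
  let Φ : SL2O → ℤ := fun g => if hermVal (-4) g 0 < 0 then 1 else 0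
  have hΦ : ∀ g, Φ (-g) = Φ g := fun g => by simp only [Φ, hermVal_neg]
  have ha : ∀ g, Φ (g * a) = Φ g := fun g => by
    simp only [Φ, hermVal_neg_zero_mul_a (show (-4 : ℤ) ^ 2 = 16 by norm_num)]
  refine ⟨descend Φ, fun x => ?_, fun x => ?_, fun x => ?_, fun x => ?_⟩ <;>
    obtain ⟨g, rfl⟩ := proj_surjective x <;> rw [← map_mul] <;> simp only [descend_proj hΦ]
  · exact ha g
  · rw [b_eq, ← mul_assoc, ← ha g]
    simp only [Φ, hermVal_mul_t]
  · simp only [Φ, hermVal_mul_u]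
  · rw [← map_mul, ← map_inv, ← map_mul, ← map_mul, ← b'_eq, proj_mem_closure_iff]
    have h := sign_change_iff (herm_discriminant (k := -4) (by norm_num) g) (hermTrace_modEq _ g)
      (by rw [← hermVal_mul_c]; exact hermVal_ne_zero (by norm_num) _)
    rw [← hermVal_mul_c] at h
    unfold FixesForm
    convert h

end SL2O

/-! ### Separating functions for the modular group -/

section Modular

open ModularGroup
open scoped MatrixGroups

theorem mul_nonpos_of_det_eq_one {p q r s : ℤ} (h : p * s - q * r = 1) (h₁ : p * r ≤ 0)
    (h₂ : q * s ≤ 0) (h₃ : p * r < 0 ∨ q * s < 0) : (q - p) * (s - r) ≤ 0 := by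
  by_contra! h₄
  have key : ∀ {p q r s : ℤ}, p * s - q * r = 1 → p < q → r < s → 0 ≤ p → s ≤ 0 →
      p * r < 0 ∨ q * s < 0 → False := by
    intro p q r s h hpq hrs hp hs h'
    have h₁ : 0 ≤ (q - p - 1) * -r := mul_nonneg (by omega) (by omega)
    have h₂ : 0 ≤ p * (s - r - 1) := mul_nonneg hp (by omega)
    have h₃ : p - r ≤ 1 := by linarith
    rcases h' with h' | h'
    · have : 0 < p := lt_of_le_of_ne hp (by rintro rfl; simp at h')
      omega
    · have : s < 0 := lt_of_le_of_ne hs (by rintro rfl; simp at h')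
      omega
  rcases mul_pos_iff.1 h₄ with ⟨h₅, h₆⟩ | ⟨h₅, h₆⟩ <;>
  rcases mul_nonpos_iff.1 h₁ with ⟨h₇, h₈⟩ | ⟨h₇, h₈⟩ <;>
  rcases mul_nonpos_iff.1 h₂ with ⟨h₉, h₁₀⟩ | ⟨h₉, h₁₀⟩
  · exact key h (by omega) (by omega) h₇ h₁₀ h₃
  · omega
  · nlinarith
  · nlinarith
  · nlinarith
  · nlinarith
  · omega
  · exact key (p := -p) (q := -q) (r := -r) (s := -s) (by linarith) (by omega) (by omega)
      (by omega) (by omega) (by simpa using h₃)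

theorem isOne_of_det_eq_one {p q r s : ℤ} (h : p * s - q * r = 1) (h₁ : p * r = 0)
    (h₂ : q * s = 0) (h₃ : (q - p) * (s - r) ≤ 0) :
    (p = 1 ∧ q = 0 ∧ r = 0 ∧ s = 1) ∨ (p = -1 ∧ q = 0 ∧ r = 0 ∧ s = -1) := by
  rcases mul_eq_zero.1 h₁ with rfl | rfl
  · rcases mul_eq_zero.1 h₂ with rfl | rfl
    · simp at h
    · nlinarith
  · have h₄ : p * s = 1 := by linarith
    rcases Int.mul_eq_one_iff_eq_one_or_neg_one.1 h₄ with ⟨rfl, rfl⟩ | ⟨rfl, rfl⟩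
    · left
      omega
    · right
      omega

namespace SL2O

/-- The function on the modular group separating the conjugates of the subgroup of `S`. -/
def sepS (X : SL(2, ℤ)) : ℤ :=
  if X 0 0 * X 1 0 ≤ 0 ∧ X 0 1 * X 1 1 ≤ 0 ∧ (X 0 0 * X 1 0 < 0 ∨ X 0 1 * X 1 1 < 0) then 1 else 0

/-- The function on the modular group separating the conjugates of the subgroup of `S * T`. -/
def sepST (X : SL(2, ℤ)) : ℤ :=
  if X 0 0 * X 1 0 ≤ 0 ∧ X 0 1 * X 1 1 ≤ 0 ∧ (X 0 1 - X 0 0) * (X 1 1 - X 1 0) ≤ 0 then 1 else 0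

theorem int_neg_apply (X : SL(2, ℤ)) (i j : Fin 2) : (-X) i j = -X i j := by
  rw [Matrix.SpecialLinearGroup.coe_neg, Matrix.neg_apply]

theorem int_eq_one_iff (X : SL(2, ℤ)) :
    X = 1 ↔ X 0 0 = 1 ∧ X 0 1 = 0 ∧ X 1 0 = 0 ∧ X 1 1 = 1 := by
  simp only [Matrix.SpecialLinearGroup.ext_iff, Fin.forall_fin_two]
  simp [and_assoc]

theorem int_eq_neg_one_iff (X : SL(2, ℤ)) :
    X = -1 ↔ X 0 0 = -1 ∧ X 0 1 = 0 ∧ X 1 0 = 0 ∧ X 1 1 = -1 := by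
  simp only [Matrix.SpecialLinearGroup.ext_iff, Fin.forall_fin_two, int_neg_apply]
  simp [and_assoc]

theorem eq_one_iff (g : SL2O) :
    g = 1 ↔ ((g 0 0).re = 1 ∧ (g 0 0).im = 0) ∧ ((g 0 1).re = 0 ∧ (g 0 1).im = 0) ∧
      ((g 1 0).re = 0 ∧ (g 1 0).im = 0) ∧ (g 1 1).re = 1 ∧ (g 1 1).im = 0 := by
  constructor
  · rintro rfl
    exact ⟨⟨rfl, rfl⟩, ⟨rfl, rfl⟩, ⟨rfl, rfl⟩, rfl, rfl⟩
  · rintro ⟨h₁, h₂, h₃, h₄⟩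
    exact ext_entries (QuadraticAlgebra.ext h₁.1 h₁.2) (QuadraticAlgebra.ext h₂.1 h₂.2)
      (QuadraticAlgebra.ext h₃.1 h₃.2) (QuadraticAlgebra.ext h₄.1 h₄.2)

theorem eq_neg_one_iff (g : SL2O) :
    g = -1 ↔ ((g 0 0).re = -1 ∧ (g 0 0).im = 0) ∧ ((g 0 1).re = 0 ∧ (g 0 1).im = 0) ∧
      ((g 1 0).re = 0 ∧ (g 1 0).im = 0) ∧ (g 1 1).re = -1 ∧ (g 1 1).im = 0 := by
  rw [← neg_eq_iff_eq_neg, eq_one_iff]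
  simp only [neg_apply, QuadraticAlgebra.re_neg, QuadraticAlgebra.im_neg, neg_eq_iff_eq_neg,
    neg_zero]

theorem int_mul_S_apply (X : SL(2, ℤ)) (i : Fin 2) :
    (X * S) i 0 = X i 1 ∧ (X * S) i 1 = -X i 0 := by
  simp only [int_mul_apply]
  simp [S]

theorem int_mul_T_apply (X : SL(2, ℤ)) (i : Fin 2) :
    (X * T) i 0 = X i 0 ∧ (X * T) i 1 = X i 0 + X i 1 := by
  simp only [int_mul_apply]
  simp [T]

theorem sepS_neg (X : SL(2, ℤ)) : sepS (-X) = sepS X := by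
  simp only [sepS, int_neg_apply, neg_mul_neg]

theorem sepST_neg (X : SL(2, ℤ)) : sepST (-X) = sepST X := by
  have : (-X 0 1 - -X 0 0) * (-X 1 1 - -X 1 0) = (X 0 1 - X 0 0) * (X 1 1 - X 1 0) := by ring
  simp only [sepST, int_neg_apply, neg_mul_neg, this]

theorem sepS_mul_S (X : SL(2, ℤ)) : sepS (X * S) = sepS X := by
  unfold sepS
  simp only [int_mul_S_apply, neg_mul_neg]
  congr 1
  exact propext (by tauto)

theorem sepST_mul_S_mul_T (X : SL(2, ℤ)) : sepST (X * (S * T)) = sepST X := by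
  unfold sepST
  simp only [← mul_assoc, int_mul_T_apply, int_mul_S_apply]
  have h₁ : (X 0 1 + -X 0 0) * (X 1 1 + -X 1 0) = (X 0 1 - X 0 0) * (X 1 1 - X 1 0) := by ring
  have h₂ : (X 0 1 + -X 0 0 - X 0 1) * (X 1 1 + -X 1 0 - X 1 1) = X 0 0 * X 1 0 := by ring
  rw [h₁, h₂]
  congr 1
  exact propext (by tauto)

theorem sepST_sub_sepS (X : SL(2, ℤ)) [Decidable (X = 1 ∨ X = -1)] :
    sepST X - sepS X = if X = 1 ∨ X = -1 then 1 else 0 := by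
  have hdet := int_det X
  simp only [int_eq_one_iff, int_eq_neg_one_iff]
  unfold sepS sepST
  have h₁ := mul_nonpos_of_det_eq_one hdet
  have h₂ := isOne_of_det_eq_one hdet
  generalize X 0 0 = p at *
  generalize X 0 1 = q at *
  generalize X 1 0 = r at *
  generalize X 1 1 = s at *
  by_cases h : (p = 1 ∧ q = 0 ∧ r = 0 ∧ s = 1) ∨ (p = -1 ∧ q = 0 ∧ r = 0 ∧ s = -1)
  · rcases h with ⟨rfl, rfl, rfl, rfl⟩ | ⟨rfl, rfl, rfl, rfl⟩ <;> norm_num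
  · rw [if_neg h, sub_eq_zero]
    congr 1
    refine propext ⟨?_, ?_⟩
    · rintro ⟨k₁, k₂, k₃⟩
      refine ⟨k₁, k₂, ?_⟩
      by_contra! k₄
      exact h (h₂ (le_antisymm k₁ k₄.1) (le_antisymm k₂ k₄.2) k₃)
    · rintro ⟨k₁, k₂, k₃⟩
      exact ⟨k₁, k₂, h₁ k₁ k₂ k₃⟩

open Classical in
/-- The extension by zero along a homomorphism of a function on the modular group. -/
noncomputable def extendByZero {G : Type} [Group G] (φ : SL(2, ℤ) →* G) (f : SL(2, ℤ) → ℤ)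
    (g : G) : ℤ :=
  if h : g ∈ φ.range then f h.choose else 0

section ExtendByZero

variable {G : Type} [Group G] {φ : SL(2, ℤ) →* G} {f : SL(2, ℤ) → ℤ}

theorem extendByZero_apply (hφ : ∀ X, φ X = 1 → X = 1 ∨ X = -1) (hf : ∀ X, f (-X) = f X)
    (X : SL(2, ℤ)) : extendByZero φ f (φ X) = f X := by
  have h : φ X ∈ φ.range := ⟨X, rfl⟩
  rw [extendByZero, dif_pos h]
  have h₁ : h.choose * X⁻¹ = 1 ∨ h.choose * X⁻¹ = -1 :=
    hφ _ (by rw [map_mul, map_inv, h.choose_spec, mul_inv_cancel])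
  rw [mul_inv_eq_iff_eq_mul, mul_inv_eq_iff_eq_mul, one_mul, neg_one_mul] at h₁
  rcases h₁ with h₁ | h₁
  · rw [h₁]
  · rw [h₁, hf]

theorem extendByZero_of_notMem {g : G} (hg : g ∉ φ.range) : extendByZero φ f g = 0 := dif_neg hg

theorem extendByZero_mul (hφ : ∀ X, φ X = 1 → X = 1 ∨ X = -1) (hf : ∀ X, f (-X) = f X)
    {Y : SL(2, ℤ)} (hY : ∀ X, f (X * Y) = f X) (g : G) :
    extendByZero φ f (g * φ Y) = extendByZero φ f g := by
  by_cases hg : g ∈ φ.range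
  · obtain ⟨X, rfl⟩ := hg
    rw [← map_mul, extendByZero_apply hφ hf, extendByZero_apply hφ hf, hY]
  · rw [extendByZero_of_notMem hg, extendByZero_of_notMem]
    rwa [Subgroup.mul_mem_cancel_right _ (MonoidHom.mem_range.2 ⟨Y, rfl⟩)]

end ExtendByZero

open Classical in
theorem exists_separating_of_hom {G : Type} [Group G] (φ : SL(2, ℤ) →* G)
    (hφ : ∀ X, φ X = 1 ↔ X = 1 ∨ X = -1) :
    ∃ Φ Ψ : G → ℤ, (∀ g, Φ (g * φ S) = Φ g) ∧ (∀ g, Ψ (g * φ (S * T)) = Ψ g) ∧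
      ∀ g, Ψ g - Φ g = if g = 1 then 1 else 0 := by
  have hφ' := fun X => (hφ X).1
  refine ⟨extendByZero φ sepS, extendByZero φ sepST, extendByZero_mul hφ' sepS_neg sepS_mul_S,
    extendByZero_mul hφ' sepST_neg sepST_mul_S_mul_T, fun g => ?_⟩
  by_cases hg : g ∈ φ.range
  · obtain ⟨X, rfl⟩ := hg
    rw [extendByZero_apply hφ' sepS_neg, extendByZero_apply hφ' sepST_neg, sepST_sub_sepS]
    simp only [hφ]
  · rw [extendByZero_of_notMem hg, extendByZero_of_notMem hg, if_neg, sub_zero]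
    rintro rfl
    exact hg (one_mem _)

/-- The inclusion of the modular group. -/
def ofInt : SL(2, ℤ) →* SL2O := Matrix.SpecialLinearGroup.map (Int.castRingHom O15)

theorem ofInt_apply (X : SL(2, ℤ)) (i j : Fin 2) : ofInt X i j = (X i j : O15) := rfl

theorem ofInt_S : ofInt S = a := by
  apply ext_entries <;> rw [ofInt_apply] <;> simp [S, a]

theorem ofInt_T : ofInt T = t := by
  apply ext_entries <;> rw [ofInt_apply] <;> simp [T, t]

theorem ofInt_S_mul_T : ofInt (S * T) = b := by
  rw [map_mul, ofInt_S, ofInt_T, b_eq]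

theorem proj_ofInt_eq_one_iff (X : SL(2, ℤ)) : (proj.comp ofInt) X = 1 ↔ X = 1 ∨ X = -1 := by
  rw [MonoidHom.comp_apply, proj_eq_one_iff]
  simp only [eq_one_iff, eq_neg_one_iff, int_eq_one_iff, int_eq_neg_one_iff, ofInt_apply]
  simp

theorem proj_modularEmbedding_eq_one_iff (X : SL(2, ℤ)) :
    (proj.comp modularEmbedding) X = 1 ↔ X = 1 ∨ X = -1 := by
  rw [MonoidHom.comp_apply, proj_eq_one_iff]
  change modularFun X = 1 ∨ modularFun X = -1 ↔ _
  simp only [eq_one_iff, eq_neg_one_iff, int_eq_one_iff, int_eq_neg_one_iff]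
  simp only [modularFun, ofEntries_zero_zero, ofEntries_zero_one, ofEntries_one_zero,
    ofEntries_one_one]
  omega

end SL2O

end Modular

/-! ### The edge group of the stable letter `u` -/

section IntegerLemmas

variable {p₁ p₂ q₁ q₂ r₁ r₂ s₁ s₂ : ℤ}

theorem norm_pos {x y : ℤ} (h : x ≠ 0 ∨ y ≠ 0) : 0 < x ^ 2 + x * y + 4 * y ^ 2 := by
  rcases h with h | h
  · nlinarith [sq_nonneg (x + 8 * y), sq_pos_of_ne_zero h]
  · nlinarith [sq_nonneg (2 * x + y), sq_pos_of_ne_zero h]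

theorem eq_of_norm_eq_one {x y : ℤ} (h : x ^ 2 + x * y + 4 * y ^ 2 = 1) :
    (x = 1 ∨ x = -1) ∧ y = 0 := by
  have hy : y = 0 := by
    by_contra hy
    nlinarith [sq_nonneg (2 * x + y), Int.one_le_abs hy, sq_abs y, abs_nonneg y]
  subst hy
  exact ⟨mul_self_eq_one_iff.1 (by linarith), rfl⟩

theorem separating_identity (h₁ : p₁ * s₁ - 4 * p₂ * s₂ - q₁ * r₁ + 4 * q₂ * r₂ = 1)
    (h₂ : p₁ * s₂ + p₂ * s₁ + p₂ * s₂ - q₁ * r₂ - q₂ * r₁ - q₂ * r₂ = 0) :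
    (r₁ * p₂ - r₂ * p₁) * (s₂ * r₁ - s₁ * r₂) -
      (s₂ * p₂ - r₂ * q₂) * (r₁ ^ 2 + r₁ * r₂ + 4 * r₂ ^ 2) = r₂ ^ 2 := by
  linear_combination r₂ ^ 2 * h₁ - r₁ * r₂ * h₂

/-- The sign condition defining the separating function is decided by the first column. -/
theorem sign_condition_iff (h₁ : p₁ * s₁ - 4 * p₂ * s₂ - q₁ * r₁ + 4 * q₂ * r₂ = 1)
    (h₂ : p₁ * s₂ + p₂ * s₁ + p₂ * s₂ - q₁ * r₂ - q₂ * r₁ - q₂ * r₂ = 0)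
    {A D f m n : ℤ} (hA : A = s₂ * r₁ - s₁ * r₂) (hD : D = q₂ * p₁ - q₁ * p₂)
    (hf : f = 2 * (2 + 15 * (s₂ * p₂ - r₂ * q₂)) - 15 * A)
    (hn : n = r₁ ^ 2 + r₁ * r₂ + 4 * r₂ ^ 2) (hm : m = 2 * (r₁ * p₂ - r₂ * p₁) - n)
    (hn0 : 0 < n) (hm0 : m ≠ 0) :
    ((A ≠ 0 ∧ 0 < f * A) ∨ (A = 0 ∧ 1 ≤ D)) ↔ 0 < m := by
  have key : 15 * m * A - f * n = 30 * r₂ ^ 2 - 4 * n := by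
    rw [hm, hf]
    linear_combination 30 * separating_identity h₁ h₂ + 30 * (r₁ * p₂ - r₂ * p₁) * hA -
      30 * (s₂ * p₂ - r₂ * q₂) * hn
  have hlow : -(4 * n) ≤ 15 * m * A - f * n := by nlinarith [sq_nonneg r₂]
  have hupp : 15 * m * A - f * n ≤ 4 * n := by nlinarith [sq_nonneg (2 * r₁ + r₂)]
  have hmod : ∃ z, f = 4 + 15 * z := ⟨2 * (s₂ * p₂ - r₂ * q₂) - A, by rw [hf]; ring⟩
  have hf_pos : -4 * n < f * n → 0 < f := fun h => by
    have := lt_of_mul_lt_mul_right h hn0.le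
    omega
  have hf_neg : f * n < 4 * n → f < 0 := fun h => by
    have := lt_of_mul_lt_mul_right h hn0.le
    omega
  rcases lt_trichotomy A 0 with hA0 | hA0 | hA0
  · have : (A ≠ 0 ∧ 0 < f * A) ∨ (A = 0 ∧ 1 ≤ D) ↔ f < 0 := by
      constructor
      · rintro (⟨-, h⟩ | ⟨h, -⟩)
        · nlinarith
        · omega
      · exact fun h => Or.inl ⟨hA0.ne, mul_pos_of_neg_of_neg h hA0⟩
    rw [this]
    constructor
    · intro h
      by_contra hm'
      have hm1 : m < 0 := by omega
      have := hf_pos (by nlinarith)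
      omega
    · intro h
      exact hf_neg (by nlinarith)
  · have hr₂ : f = 4 ∧ r₂ = 0 := by
      rw [hA0, mul_zero, zero_sub] at key hlow hupp
      have hf4 : f = 4 := by
        have h1 : -4 ≤ f := by nlinarith
        have h2 : f ≤ 4 := by nlinarith
        omega
      refine ⟨hf4, ?_⟩
      rw [hf4] at key
      have : r₂ ^ 2 = 0 := by linarith
      exact pow_eq_zero_iff two_ne_zero |>.1 this
    obtain ⟨hf4, rfl⟩ := hr₂
    have hr₁ : r₁ ≠ 0 := by
      rintro rfl
      simp [hn] at hn0
    have hs₂ : s₂ = 0 := by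
      rw [hA] at hA0
      have : s₂ * r₁ = 0 := by linarith
      exact (mul_eq_zero.1 this).resolve_right hr₁
    subst hs₂
    have hp₂ : p₂ = D * r₁ := by
      rw [hD]
      linear_combination -p₂ * h₁ + p₁ * h₂
    have hm' : m = (2 * D - 1) * n := by
      rw [hm, hn, hp₂]
      ring
    have hpos : 0 < m ↔ 0 < 2 * D - 1 := by rw [hm', mul_pos_iff_of_pos_right hn0]
    rw [hpos]
    clear * - hA0
    constructor
    · rintro (⟨h, -⟩ | ⟨-, h⟩)
      · exact absurd hA0 h
      · omega
    · exact fun h => Or.inr ⟨hA0, by omega⟩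
  · have : (A ≠ 0 ∧ 0 < f * A) ∨ (A = 0 ∧ 1 ≤ D) ↔ 0 < f := by
      constructor
      · rintro (⟨-, h⟩ | ⟨h, -⟩)
        · exact pos_of_mul_pos_left h hA0.le
        · omega
      · exact fun h => Or.inl ⟨hA0.ne', mul_pos h hA0⟩
    rw [this]
    constructor
    · intro h
      by_contra hm'
      have hm1 : m < 0 := by omega
      have := hf_neg (by nlinarith)
      omega
    · intro h
      exact hf_pos (by nlinarith)

/-- A progression with difference `2 * Y` meets the interval from `-Y` to `Y`. -/
theorem exists_mul_nonpos {X Y : ℤ} (hY : 0 < Y) : ∃ j : ℤ,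
    (X + j * (2 * Y)) * (X + j * (2 * Y) + Y) ≤ 0 ∨
      (X + j * (2 * Y)) * (X + j * (2 * Y) - Y) ≤ 0 := by
  have h := Int.emod_add_mul_ediv X (2 * Y)
  have h₁ := Int.emod_nonneg X (show 2 * Y ≠ 0 by omega)
  have h₂ := Int.emod_lt_of_pos X (show 0 < 2 * Y by omega)
  generalize X % (2 * Y) = ρ at *
  generalize X / (2 * Y) = k at *
  by_cases hρ : ρ ≤ Y
  · refine ⟨-k, Or.inr ?_⟩
    rw [show X + -k * (2 * Y) = ρ by linarith]
    exact mul_nonpos_of_nonneg_of_nonpos h₁ (by omega)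
  · refine ⟨-k - 1, Or.inl ?_⟩
    rw [show X + (-k - 1) * (2 * Y) = ρ - 2 * Y by linarith]
    exact mul_nonpos_of_nonpos_of_nonneg (by omega) (by omega)

end IntegerLemmas

namespace SL2O

open QuadraticAlgebra

/-- The upper unitriangular matrices, as a homomorphism from the additive group. -/
def translation : Multiplicative O15 →* SL2O where
  toFun x := ofEntries 1 x.toAdd 0 1 (by ring)
  map_one' := by
    apply ext_entries <;> rfl
  map_mul' x y := by
    apply ext_entries <;> rw [mul_apply] <;> simp [add_comm]

theorem translation_apply (x : O15) :
    translation (.ofAdd x) = ofEntries 1 x 0 1 (by ring) := rfl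

theorem translation_eq (x : O15) : translation (.ofAdd x) = t ^ x.re * u ^ x.im := by
  have ht : t = translation (.ofAdd 1) := by
    apply ext_entries <;> rfl
  have hu : u = translation (.ofAdd ⟨0, 1⟩) := by
    apply ext_entries <;> rfl
  rw [ht, hu, ← MonoidHom.map_zpow, ← MonoidHom.map_zpow, ← MonoidHom.map_mul, ← ofAdd_zsmul,
    ← ofAdd_zsmul, ← ofAdd_add]
  congr 2
  ext <;> simp

theorem t_zpow (k : ℤ) : t ^ k = ofEntries 1 ⟨k, 0⟩ 0 1 (by ring) := by
  rw [← translation_apply, translation_eq]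
  simp

theorem u_zpow (k : ℤ) : u ^ k = ofEntries 1 ⟨0, k⟩ 0 1 (by ring) := by
  rw [← translation_apply, translation_eq]
  simp

theorem a_mul_a : a * a = -1 := by
  rw [eq_neg_one_iff]
  simp only [mul_apply]
  simp [a]

theorem a_mul_b : a * b = -t := by
  rw [b_eq, ← mul_assoc, a_mul_a, neg_one_mul]

theorem proj_a_mul_proj_b : proj a * proj b = proj t := by
  rw [← map_mul, a_mul_b, proj_neg]

/-- A matrix with vanishing lower left entry is a translation up to sign. -/
theorem eq_translation_of_apply_eq_zero {g : SL2O} (h : g 1 0 = 0) :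
    (g 0 0 = 1 ∧ g = translation (.ofAdd (g 0 1))) ∨
      (g 0 0 = -1 ∧ g = -translation (.ofAdd (-g 0 1))) := by
  have d₁ := g.det_re
  have d₂ := g.det_im
  have hdet : g 0 0 * g 1 1 = 1 := by
    rw [h] at d₁ d₂
    ext
    · simp at d₁ ⊢
      linarith
    · simp at d₂ ⊢
      linarith
  have hnorm : ((g 0 0).re ^ 2 + (g 0 0).re * (g 0 0).im + 4 * (g 0 0).im ^ 2) *
      ((g 1 1).re ^ 2 + (g 1 1).re * (g 1 1).im + 4 * (g 1 1).im ^ 2) = 1 := by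
    rw [h] at d₁ d₂
    simp at d₁ d₂
    linear_combination ((g 0 0).re * (g 1 1).re - 4 * (g 0 0).im * (g 1 1).im + 1) * d₁ +
      ((g 0 0).re * (g 1 1).re - 4 * (g 0 0).im * (g 1 1).im +
        4 * ((g 0 0).re * (g 1 1).im + (g 0 0).im * (g 1 1).re + (g 0 0).im * (g 1 1).im)) * d₂
  have hone : (g 0 0).re ^ 2 + (g 0 0).re * (g 0 0).im + 4 * (g 0 0).im ^ 2 = 1 := by
    rcases Int.mul_eq_one_iff_eq_one_or_neg_one.1 hnorm with ⟨h, -⟩ | ⟨h, -⟩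
    · exact h
    · nlinarith [sq_nonneg (2 * (g 0 0).re + (g 0 0).im), sq_nonneg (g 0 0).im]
  obtain ⟨h₁ | h₁, h₂⟩ := eq_of_norm_eq_one hone
  · have hp : g 0 0 = 1 := QuadraticAlgebra.ext h₁ h₂
    rw [hp, one_mul] at hdet
    exact Or.inl ⟨hp, ext_entries hp rfl h hdet⟩
  · have hp : g 0 0 = -1 := by
      ext
      · simpa using h₁
      · simpa using h₂
    rw [hp, neg_one_mul, neg_eq_iff_eq_neg] at hdet
    refine Or.inr ⟨hp, ext_entries ?_ ?_ ?_ ?_⟩ <;> rw [neg_apply, translation_apply]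
    · exact hp
    · simp
    · simpa using h
    · exact hdet

theorem proj_mem_zpowers_iff (g : SL2O) :
    proj g ∈ Subgroup.zpowers (proj t) ↔ g 1 0 = 0 ∧ (g 0 1).im = 0 := by
  constructor
  · rintro ⟨k, hk⟩
    change proj t ^ k = proj g at hk
    rw [← map_zpow, eq_comm, proj_eq_proj_iff, t_zpow] at hk
    rcases hk with rfl | rfl
    · simp
    · simp [neg_apply]
  · rintro ⟨h₁, h₂⟩
    rcases eq_translation_of_apply_eq_zero h₁ with ⟨-, h⟩ | ⟨-, h⟩
    · rw [h, translation_eq, h₂, zpow_zero, mul_one, map_zpow]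
      exact zpow_mem (Subgroup.mem_zpowers _) _
    · rw [h, proj_neg, translation_eq, im_neg, h₂, neg_zero, zpow_zero, mul_one, map_zpow]
      exact zpow_mem (Subgroup.mem_zpowers _) _

/-- The subgroup generated by `a` and the translations. -/
def bianchiBase : Subgroup SL2O := Subgroup.closure {a, t, u}

theorem a_mem_base : a ∈ bianchiBase := Subgroup.subset_closure (by simp)

theorem t_mem_base : t ∈ bianchiBase := Subgroup.subset_closure (by simp)

theorem u_mem_base : u ∈ bianchiBase := Subgroup.subset_closure (by simp)

theorem neg_mem_base {g : SL2O} : -g ∈ bianchiBase ↔ g ∈ bianchiBase := by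
  have h : (-1 : SL2O) ∈ bianchiBase := a_mul_a ▸ mul_mem a_mem_base a_mem_base
  rw [← neg_one_mul g, Subgroup.mul_mem_cancel_left _ h]

theorem hermVal_pos_of_mem_base {k : ℤ} (hk : k ^ 2 = 16) {g : SL2O} (hg : g ∈ bianchiBase) :
    0 < hermVal k g 0 := by
  have hinv : ∀ x ∈ ({a, t, u} : Set SL2O), ∀ g : SL2O,
      hermVal k (g * x) 0 < 0 ↔ hermVal k g 0 < 0 := by
    rintro x (rfl | rfl | rfl) g
    · exact hermVal_neg_zero_mul_a hk g
    · rw [hermVal_mul_t]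
    · rw [hermVal_mul_u]
  have hnot : ¬ hermVal k g 0 < 0 := by
    induction hg using Subgroup.closure_induction_right with
    | one => simp [hermVal]
    | mul_right x _ y hy ih => rwa [hinv y hy]
    | mul_inv_cancel x _ y hy ih => rwa [← hinv y hy, inv_mul_cancel_right]
  exact lt_of_le_of_ne (not_lt.1 hnot) (hermVal_ne_zero hk g).symm

/-- The first column of an element of the base is not on the fixed line of the involution. -/
theorem norm_ne_of_mem_base {g : SL2O} (hg : g ∈ bianchiBase) (hr : g 1 0 ≠ 0) :
    2 * ((g 1 0).re * (g 0 0).im - (g 1 0).im * (g 0 0).re) ≠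
      (g 1 0).re ^ 2 + (g 1 0).re * (g 1 0).im + 4 * (g 1 0).im ^ 2 := by
  intro h
  have hn : 0 < (g 1 0).re ^ 2 + (g 1 0).re * (g 1 0).im + 4 * (g 1 0).im ^ 2 := by
    apply norm_pos
    by_contra! h'
    exact hr (QuadraticAlgebra.ext h'.1 h'.2)
  obtain ⟨j, hj⟩ := exists_mul_nonpos
    (X := (g 0 0).re * ((g 1 0).re + (g 1 0).im) + 4 * (g 0 0).im * (g 1 0).im)
    (Y := (g 1 0).re * (g 0 0).im - (g 1 0).im * (g 0 0).re) (by omega)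
  have hp₁ := hermVal_pos_of_mem_base (k := 4) (by norm_num)
    (mul_mem (zpow_mem t_mem_base j) hg)
  have hp₂ := hermVal_pos_of_mem_base (k := -4) (by norm_num)
    (mul_mem (zpow_mem u_mem_base (-1)) (mul_mem (zpow_mem t_mem_base j) hg))
  unfold hermVal at hp₁ hp₂
  simp only [mul_apply, t_zpow, u_zpow] at hp₁ hp₂
  simp at hp₁ hp₂
  generalize (g 0 0).re = p₁ at *
  generalize (g 0 0).im = p₂ at *
  generalize (g 1 0).re = r₁ at *
  generalize (g 1 0).im = r₂ at *
  rw [h] at hj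
  generalize hX : p₁ * (r₁ + r₂) + 4 * p₂ * r₂ + j * (r₁ ^ 2 + r₁ * r₂ + 4 * r₂ ^ 2) = X at hj
  rcases hj with hj | hj
  · refine hj.not_gt (lt_of_lt_of_eq (mul_pos hn hp₁) ?_)
    rw [← hX]
    linear_combination (2 * (r₁ * p₂ - r₂ * p₁) - (r₁ ^ 2 + r₁ * r₂ + 4 * r₂ ^ 2)) * h
  · refine hj.not_gt (lt_of_lt_of_eq (mul_pos hn (sub_pos.2 hp₂)) ?_)
    rw [← hX]
    linear_combination (p₁ * (r₁ + r₂) + 4 * p₂ * r₂ + j * (r₁ ^ 2 + r₁ * r₂ + 4 * r₂ ^ 2) +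
      2 * (r₁ * p₂ - r₂ * p₁) - (r₁ ^ 2 + r₁ * r₂ + 4 * r₂ ^ 2)) * h

/-- The sign condition that changes exactly along the edge group of the stable letter `u`. -/
def SignCondition (g : SL2O) : Prop :=
  ((g 1 1).im * (g 1 0).re - (g 1 1).re * (g 1 0).im ≠ 0 ∧
    0 < (2 * (2 + 15 * ((g 1 1).im * (g 0 0).im - (g 1 0).im * (g 0 1).im)) -
      15 * ((g 1 1).im * (g 1 0).re - (g 1 1).re * (g 1 0).im)) *
      ((g 1 1).im * (g 1 0).re - (g 1 1).re * (g 1 0).im)) ∨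
  ((g 1 1).im * (g 1 0).re - (g 1 1).re * (g 1 0).im = 0 ∧
    1 ≤ (g 0 1).im * (g 0 0).re - (g 0 1).re * (g 0 0).im)

theorem signCondition_mul_a (g : SL2O) : SignCondition (g * a) ↔ SignCondition g := by
  unfold SignCondition
  simp only [mul_a_apply, re_neg, im_neg]
  ring_nf

theorem signCondition_mul_t (g : SL2O) : SignCondition (g * t) ↔ SignCondition g := by
  unfold SignCondition
  simp only [mul_t_apply, re_add, im_add]
  ring_nf

theorem signCondition_neg (g : SL2O) : SignCondition (-g) ↔ SignCondition g := by
  unfold SignCondition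
  simp only [neg_apply, re_neg, im_neg]
  ring_nf

theorem signCondition_iff_of_ne {g : SL2O} (hg : g ∈ bianchiBase) (hr : g 1 0 ≠ 0) :
    SignCondition g ↔ 0 < 2 * ((g 1 0).re * (g 0 0).im - (g 1 0).im * (g 0 0).re) -
      ((g 1 0).re ^ 2 + (g 1 0).re * (g 1 0).im + 4 * (g 1 0).im ^ 2) := by
  refine sign_condition_iff g.det_re g.det_im rfl rfl rfl rfl rfl (norm_pos ?_)
    (sub_ne_zero.2 (norm_ne_of_mem_base hg hr))
  by_contra! h'
  exact hr (QuadraticAlgebra.ext h'.1 h'.2)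

open Classical in
theorem signCondition_mul_u {g : SL2O} (hg : g ∈ bianchiBase) :
    ((if SignCondition (g * u) then 1 else 0) - (if SignCondition g then 1 else 0) : ℤ) =
      if g 1 0 = 0 ∧ (g 0 1).im = 0 then 1 else 0 := by
  by_cases hr : g 1 0 = 0
  · have hD : ∀ h : SL2O, h 1 0 = 0 →
        (SignCondition h ↔ 1 ≤ (h 0 1).im * (h 0 0).re - (h 0 1).re * (h 0 0).im) := fun h hh => by
      simp [SignCondition, hh]
    rw [hD g hr, hD _ (by rw [(mul_u_apply g 1).1, hr])]
    simp only [mul_u_apply, hr, true_and]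
    rcases eq_translation_of_apply_eq_zero hr with ⟨hp, -⟩ | ⟨hp, -⟩ <;>
      simp [hp] <;> split_ifs <;> omega
  · rw [if_neg (c := g 1 0 = 0 ∧ _) (fun h => hr h.1), sub_eq_zero, signCondition_iff_of_ne hg hr,
      signCondition_iff_of_ne (mul_mem hg u_mem_base) (by rwa [(mul_u_apply g 1).1])]
    simp only [mul_u_apply]
    congr

open Classical in
theorem exists_separating_u : ∃ Φ : PSL2 O15 → ℤ, (∀ g, Φ (g * proj a) = Φ g) ∧
    (∀ g, Φ (g * proj b) = Φ g) ∧
    ∀ g, Φ (g * proj u) - Φ g =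
      if g ∈ Subgroup.zpowers (proj a * proj b) then 1 else 0 := by
  let Φ : SL2O → ℤ := fun g => if g ∈ bianchiBase ∧ SignCondition g then 1 else 0
  have hΦ : ∀ g, Φ (-g) = Φ g := fun g => by
    simp only [Φ, neg_mem_base, signCondition_neg]
  have ha : ∀ g, Φ (g * a) = Φ g := fun g => by
    simp only [Φ, Subgroup.mul_mem_cancel_right _ a_mem_base, signCondition_mul_a]
  refine ⟨descend Φ, fun x => ?_, fun x => ?_, fun x => ?_⟩ <;>
    obtain ⟨g, rfl⟩ := proj_surjective x <;> rw [← map_mul] <;> simp only [descend_proj hΦ]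
  · exact ha g
  · rw [b_eq, ← mul_assoc, ← ha g]
    simp only [Φ, Subgroup.mul_mem_cancel_right _ t_mem_base, signCondition_mul_t]
  · simp only [proj_a_mul_proj_b, proj_mem_zpowers_iff, Φ,
      Subgroup.mul_mem_cancel_right _ u_mem_base]
    by_cases hg : g ∈ bianchiBase
    · simp only [hg, true_and]
      exact signCondition_mul_u hg
    · simp only [hg, false_and, if_false, sub_zero]
      rw [if_neg]
      rintro ⟨h₁, h₂⟩
      refine hg ?_
      have hmem : ∀ x : O15, translation (.ofAdd x) ∈ bianchiBase := fun x => by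
        rw [translation_eq]
        exact mul_mem (zpow_mem t_mem_base _) (zpow_mem u_mem_base _)
      rcases eq_translation_of_apply_eq_zero h₁ with ⟨-, h⟩ | ⟨-, h⟩
      · rw [h]
        exact hmem _
      · rw [h, neg_mem_base]
        exact hmem _

end SL2O

theorem ford_disc_estimate {N s Y : ℤ} (hN : 0 < N) (hY : 0 < Y) (hYN : 2 * Y ≤ N) (hs : 0 ≤ s)
    (hsN : s ≤ N) (h : 4 * N ^ 2 ≤ s ^ 2 + 15 * Y ^ 2) :
    4 * N ^ 2 + s ^ 2 + 15 * Y ^ 2 < 2 * s * N + 14 * Y * N ∨ (2 * Y = N ∧ 2 * s = N) := by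
  have h₁ : N ≤ 2 * s := by
    refine le_of_sq_le_sq (by nlinarith) (by omega)
  have h₂ : 13 * N < 30 * Y := by
    refine lt_of_pow_lt_pow_left₀ 2 (by omega) ?_
    nlinarith
  have h₃ : 0 ≤ (2 * s - N) * (3 * N - 2 * s) := mul_nonneg (by omega) (by omega)
  have h₄ : 0 ≤ (N - 2 * Y) * (30 * Y - 13 * N) := mul_nonneg (by omega) (by omega)
  rcases hYN.lt_or_eq with hlt | heq
  · left
    have : 0 < (N - 2 * Y) * (30 * Y - 13 * N) := mul_pos (by omega) (by omega)
    nlinarith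
  · rcases h₁.lt_or_eq with hlt' | heq'
    · left
      have : 0 < (2 * s - N) * (3 * N - 2 * s) := mul_pos (by omega) (by omega)
      nlinarith
    · exact Or.inr ⟨heq, heq'.symm⟩

theorem exists_abs_two_mul_le {N : ℤ} (hN : 0 < N) (x : ℤ) : ∃ j : ℤ, |2 * (x + j * N)| ≤ N := by
  refine ⟨-((2 * x + N) / (2 * N)), ?_⟩
  have h₁ := Int.mul_ediv_add_emod (2 * x + N) (2 * N)
  have h₂ := Int.emod_nonneg (2 * x + N) (show 2 * N ≠ 0 by omega)
  have h₃ := Int.emod_lt_of_pos (2 * x + N) (show 0 < 2 * N by omega)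
  rw [abs_le]
  constructor <;> nlinarith

theorem exists_abs_le {N : ℤ} (hN : 0 < N) (x : ℤ) : ∃ j : ℤ, |x + 2 * (j * N)| ≤ N := by
  refine ⟨-((x + N) / (2 * N)), ?_⟩
  have h₁ := Int.mul_ediv_add_emod (x + N) (2 * N)
  have h₂ := Int.emod_nonneg (x + N) (show 2 * N ≠ 0 by omega)
  have h₃ := Int.emod_lt_of_pos (x + N) (show 0 < 2 * N by omega)
  rw [abs_le]
  constructor <;> nlinarith

/-- Every point of the plane is, up to translation by the lattice, in the interior of one of three
Ford discs, or is one of two exceptional points. -/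
theorem exists_translate_mem_disc {N : ℤ} (hN : 0 < N) (X₀ Y₀ : ℤ) : ∃ j l X Y : ℤ,
    X = X₀ + j * N ∧ Y = Y₀ + l * N ∧
    (X ^ 2 + X * Y + 4 * Y ^ 2 < N ^ 2 ∨ N ^ 2 + (X ^ 2 + X * Y + 4 * Y ^ 2) < 4 * Y * N ∨
      N ^ 2 + (X ^ 2 + X * Y + 4 * Y ^ 2) < -(4 * Y * N) ∨
      (2 * Y = N ∧ (X = 0 ∨ 2 * X = -N))) := by
  obtain ⟨l, hl⟩ := exists_abs_two_mul_le hN Y₀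
  obtain ⟨j, hj⟩ := exists_abs_le hN (2 * X₀ + (Y₀ + l * N))
  obtain ⟨X, hX⟩ : ∃ X, X = X₀ + j * N := ⟨_, rfl⟩
  obtain ⟨Y, hY⟩ : ∃ Y, Y = Y₀ + l * N := ⟨_, rfl⟩
  rw [← hY] at hl hj
  rw [show 2 * X₀ + Y + 2 * (j * N) = 2 * X + Y by rw [hX]; ring, abs_le] at hj
  rw [abs_le] at hl
  by_cases hM : X ^ 2 + X * Y + 4 * Y ^ 2 < N ^ 2
  · exact ⟨j, l, X, Y, hX, hY, Or.inl hM⟩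
  have hM' : 4 * N ^ 2 ≤ (2 * X + Y) ^ 2 + 15 * Y ^ 2 := by nlinarith
  have hY0 : Y ≠ 0 := by
    rintro rfl
    nlinarith
  rcases lt_or_gt_of_ne hY0 with hneg | hpos
  · rcases le_total 0 (2 * X + Y) with hs | hs
    · rcases ford_disc_estimate hN (Y := -Y) (s := 2 * X + Y) (by omega) (by omega) hs hj.2
        (by nlinarith) with h | ⟨h₁, h₂⟩
      · refine ⟨j - 1, l + 1, X - N, Y + N, by rw [hX]; ring, by rw [hY]; ring, ?_⟩
        right; left
        nlinarith
      · refine ⟨j - 1, l + 1, X - N, Y + N, by rw [hX]; ring, by rw [hY]; ring, ?_⟩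
        right; right; right
        omega
    · rcases ford_disc_estimate hN (Y := -Y) (s := -(2 * X + Y)) (by omega) (by omega) (by omega)
        (by omega) (by nlinarith) with h | ⟨h₁, h₂⟩
      · refine ⟨j, l + 1, X, Y + N, hX, by rw [hY]; ring, ?_⟩
        right; left
        nlinarith
      · refine ⟨j, l + 1, X, Y + N, hX, by rw [hY]; ring, ?_⟩
        right; right; right
        omega
  · rcases le_total 0 (2 * X + Y) with hs | hs
    · rcases ford_disc_estimate hN (Y := Y) (s := 2 * X + Y) hpos hl.2 hs hj.2 hM' with h | ⟨h₁, h₂⟩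
      · refine ⟨j, l - 1, X, Y - N, hX, by rw [hY]; ring, ?_⟩
        right; right; left
        nlinarith
      · refine ⟨j, l, X, Y, hX, hY, ?_⟩
        right; right; right
        omega
    · rcases ford_disc_estimate hN (Y := Y) (s := -(2 * X + Y)) hpos (by omega) (by omega)
        (by omega) (by nlinarith) with h | ⟨h₁, h₂⟩
      · refine ⟨j + 1, l - 1, X + N, Y - N, by rw [hX]; ring, by rw [hY]; ring, ?_⟩
        right; right; left
        nlinarith
      · refine ⟨j, l, X, Y, hX, hY, ?_⟩
        right; right; right
        omega

namespace SL2O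

open QuadraticAlgebra

/-- The subgroup generated by `a`, `c` and the translations. -/
def generated : Subgroup SL2O := Subgroup.closure {a, t, u, c}

theorem a_mem_generated : a ∈ generated := Subgroup.subset_closure (by simp)

theorem t_mem_generated : t ∈ generated := Subgroup.subset_closure (by simp)

theorem u_mem_generated : u ∈ generated := Subgroup.subset_closure (by simp)

theorem c_mem_generated : c ∈ generated := Subgroup.subset_closure (by simp)

theorem translation_mem_generated (x : O15) : translation (.ofAdd x) ∈ generated := by
  rw [translation_eq]
  exact mul_mem (zpow_mem t_mem_generated _) (zpow_mem u_mem_generated _)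

theorem neg_mem_generated {g : SL2O} (hg : g ∈ generated) : -g ∈ generated := by
  rw [← neg_one_mul g, ← a_mul_a]
  exact mul_mem (mul_mem a_mem_generated a_mem_generated) hg

/-- The norm of an element of `O15`. -/
def nrm (x : O15) : ℤ := x.re ^ 2 + x.re * x.im + 4 * x.im ^ 2

theorem nrm_mul (x y : O15) : nrm (x * y) = nrm x * nrm y := by
  simp [nrm]
  ring

theorem nrm_nonneg (x : O15) : 0 ≤ nrm x := by
  unfold nrm
  nlinarith [sq_nonneg (2 * x.re + x.im), sq_nonneg x.im]

theorem nrm_pos {x : O15} (hx : x ≠ 0) : 0 < nrm x := by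
  apply norm_pos
  by_contra! h
  exact hx (QuadraticAlgebra.ext h.1 h.2)

theorem nrm_ne_two (x : O15) : nrm x ≠ 2 := by
  intro h
  have h' : (2 * x.re + x.im) ^ 2 + 15 * x.im ^ 2 = 8 := by
    unfold nrm at h
    linarith
  have him : x.im = 0 := by
    by_contra hne
    have : 0 < x.im ^ 2 := by positivity
    nlinarith [sq_nonneg (2 * x.re + x.im)]
  rw [him] at h'
  have h₁ : x.re ^ 2 = 2 := by linarith
  have h₂ : x.re < 2 := by nlinarith
  have h₃ : -2 < x.re := by nlinarith
  interval_cases x.re <;> omega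

theorem two_dvd_nrm {x : O15} (h : 2 ∣ x.re ∨ 2 ∣ x.re + x.im) : 2 ∣ nrm x := by
  have : nrm x = x.re * (x.re + x.im) + 2 * (2 * x.im ^ 2) := by
    unfold nrm
    ring
  rw [this]
  refine dvd_add ?_ (dvd_mul_right _ _)
  rcases h with h | h
  · exact h.mul_right _
  · exact h.mul_left _

theorem mul_ne_two {x y : O15} (hx : 2 ∣ nrm x) (hy : 2 ∣ nrm y) : x * y ≠ 2 := by
  intro h
  have hn : nrm x * nrm y = 4 := by
    rw [← nrm_mul, h]
    rfl
  obtain ⟨m, hm⟩ := hx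
  obtain ⟨n, hn'⟩ := hy
  rw [hm, hn'] at hn
  have hmn : m * n = 1 := by linarith
  have hm0 := nrm_nonneg x
  rcases Int.mul_eq_one_iff_eq_one_or_neg_one.1 hmn with ⟨rfl, -⟩ | ⟨rfl, -⟩
  · exact nrm_ne_two x hm
  · omega

theorem det_eq (g : SL2O) : g 0 0 * g 1 1 - g 0 1 * g 1 0 = 1 := by
  have := g.det_coe
  rwa [Matrix.det_fin_two] at this

/-- The two singular points are not in the orbit of infinity. -/
theorem two_mul_apply_ne (g : SL2O) {k : ℤ} (hk : k = 0 ∨ k = -1) :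
    2 * g 0 0 ≠ ⟨k, 1⟩ * g 1 0 := by
  intro h
  have hd := det_eq g
  have hprod : g 1 0 * (⟨k, 1⟩ * g 1 1 - 2 * g 0 1) = 2 := by
    linear_combination 2 * hd - g 1 1 * h
  have h₂ := congrArg QuadraticAlgebra.im h
  refine mul_ne_two (two_dvd_nrm ?_) (two_dvd_nrm ?_) hprod
  · rcases hk with rfl | rfl <;> simp at h₂ <;> omega
  · rcases hk with rfl | rfl <;> simp <;> omega

theorem exists_nrm_lt {g : SL2O} (hr : g 1 0 ≠ 0) :
    ∃ h ∈ generated, nrm ((h * g) 1 0) < nrm (g 1 0) := by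
  have hN := nrm_pos hr
  obtain ⟨j, l, X, Y, hX, hY, h⟩ := exists_translate_mem_disc hN
    ((g 0 0).re * ((g 1 0).re + (g 1 0).im) + 4 * (g 0 0).im * (g 1 0).im)
    ((g 0 0).im * (g 1 0).re - (g 0 0).re * (g 1 0).im)
  obtain ⟨g', hg'⟩ : ∃ g', g' = translation (.ofAdd ⟨j, l⟩) * g := ⟨_, rfl⟩
  have hg₀ : g' 0 0 = g 0 0 + ⟨j, l⟩ * g 1 0 := by
    rw [hg', mul_apply, translation_apply]
    simp
  have hg₁ : g' 1 0 = g 1 0 := by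
    rw [hg', mul_apply, translation_apply]
    simp
  suffices ∃ h ∈ generated, nrm ((h * g') 1 0) < nrm (g' 1 0) by
    obtain ⟨h, hh, hlt⟩ := this
    rw [hg₁, hg', ← mul_assoc] at hlt
    exact ⟨_, mul_mem hh (translation_mem_generated _), hlt⟩
  replace hX : X = (g' 0 0).re * ((g' 1 0).re + (g' 1 0).im) + 4 * (g' 0 0).im * (g' 1 0).im := by
    rw [hX, hg₀, hg₁, nrm]
    simp
    ring
  replace hY : Y = (g' 0 0).im * (g' 1 0).re - (g' 0 0).re * (g' 1 0).im := by
    rw [hY, hg₀, hg₁, nrm]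
    simp
    ring
  rw [← hg₁] at hN h hr
  clear hg' hg₀ hg₁
  have hM : X ^ 2 + X * Y + 4 * Y ^ 2 = nrm (g' 0 0) * nrm (g' 1 0) := by
    rw [hX, hY, nrm, nrm]
    ring
  rw [hM] at h
  rcases h with h | h | h | ⟨h₁, h₂⟩
  · refine ⟨a, a_mem_generated, ?_⟩
    have : (a * g') 1 0 = g' 0 0 := by
      rw [mul_apply]
      simp [a]
    rw [this]
    nlinarith
  · refine ⟨c, c_mem_generated, ?_⟩
    have : nrm ((c * g') 1 0) = 16 * nrm (g' 1 0) + 15 * nrm (g' 0 0) - 60 * Y := by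
      rw [mul_apply, hY]
      simp [c, nrm]
      ring
    rw [this]
    nlinarith
  · refine ⟨c⁻¹, inv_mem c_mem_generated, ?_⟩
    have : nrm ((c⁻¹ * g') 1 0) = 16 * nrm (g' 1 0) + 15 * nrm (g' 0 0) + 60 * Y := by
      rw [mul_apply, hY, Matrix.SpecialLinearGroup.SL2_inv_expl]
      simp [c, nrm]
      ring
    rw [this]
    nlinarith
  · exfalso
    have key : ∀ k : ℤ, 2 * X = k * nrm (g' 1 0) → 2 * g' 0 0 = ⟨k, 1⟩ * g' 1 0 := by
      intro k hk
      have hre : nrm (g' 1 0) * (g' 0 0).re = (g' 1 0).re * X - 4 * (g' 1 0).im * Y := by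
        rw [hX, hY, nrm]
        ring
      have him : nrm (g' 1 0) * (g' 0 0).im = ((g' 1 0).re + (g' 1 0).im) * Y +
          (g' 1 0).im * X := by
        rw [hX, hY, nrm]
        ring
      ext <;> simp <;> apply mul_left_cancel₀ hN.ne'
      · linear_combination 2 * hre + (g' 1 0).re * hk - 4 * (g' 1 0).im * h₁
      · linear_combination 2 * him + (g' 1 0).im * hk + ((g' 1 0).re + (g' 1 0).im) * h₁
    rcases h₂ with h₂ | h₂
    · exact two_mul_apply_ne g' (Or.inl rfl) (key 0 (by omega))
    · exact two_mul_apply_ne g' (Or.inr rfl) (key (-1) (by omega))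

theorem mem_generated (g : SL2O) : g ∈ generated := by
  induction hn : (nrm (g 1 0)).toNat using Nat.strong_induction_on generalizing g with
  | _ n ih =>
    by_cases hr : g 1 0 = 0
    · rcases eq_translation_of_apply_eq_zero hr with ⟨-, h⟩ | ⟨-, h⟩ <;> rw [h]
      · exact translation_mem_generated _
      · exact neg_mem_generated (translation_mem_generated _)
    · obtain ⟨h, hh, hlt⟩ := exists_nrm_lt hr
      have := nrm_nonneg ((h * g) 1 0)
      exact (Subgroup.mul_mem_cancel_left _ hh).1 (ih _ (by omega) (h * g) rfl)

theorem closure_proj_eq_top :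
    Subgroup.closure {proj a, proj b, proj u, proj c} = (⊤ : Subgroup (PSL2 O15)) := by
  rw [eq_top_iff]
  intro x _
  obtain ⟨g, rfl⟩ := proj_surjective x
  have hmem : ∀ y ∈ ({proj a, proj b, proj u, proj c} : Set (PSL2 O15)),
      y ∈ Subgroup.closure {proj a, proj b, proj u, proj c} :=
    fun y hy => Subgroup.subset_closure hy
  have : generated ≤ (Subgroup.closure {proj a, proj b, proj u, proj c}).comap proj := by
    refine (Subgroup.closure_le _).2 ?_
    rintro y (rfl | rfl | rfl | rfl)
    · exact hmem _ (by simp)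
    · rw [Subgroup.coe_comap, Set.mem_preimage, ← proj_a_mul_proj_b]
      exact mul_mem (hmem _ (by simp)) (hmem _ (by simp))
    · exact hmem _ (by simp)
    · exact hmem _ (by simp)
  exact this (mem_generated g)

end SL2O

namespace SL2O

theorem orderOf_proj_a : orderOf (proj a) = 2 := by
  refine orderOf_eq_prime ?_ fun h => ?_
  · rw [sq, ← map_mul, a_mul_a, proj_neg, map_one]
  · rw [proj_eq_one_iff, eq_one_iff, eq_neg_one_iff] at h
    simp [a] at h

theorem b_pow_three : b ^ 3 = -1 := by
  rw [pow_succ, sq]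
  apply ext_entries <;> simp only [mul_apply, neg_apply] <;> simp [b]

theorem orderOf_proj_b : orderOf (proj b) = 3 := by
  refine orderOf_eq_prime ?_ fun h => ?_
  · rw [← map_pow, b_pow_three, proj_neg, map_one]
  · rw [proj_eq_one_iff, eq_one_iff, eq_neg_one_iff] at h
    simp [b] at h

theorem not_isOfFinOrder_proj_t : ¬ IsOfFinOrder (proj t) := by
  rw [isOfFinOrder_iff_pow_eq_one]
  rintro ⟨n, hn, h⟩
  rw [← zpow_natCast, ← map_zpow, proj_eq_one_iff, t_zpow, eq_one_iff, eq_neg_one_iff] at h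
  simp at h
  omega

theorem t_mul_u : t * u = u * t := by
  apply ext_entries <;> simp only [mul_apply] <;> simp [t, u, add_comm]

theorem a_mul_c : a * c = c * a := by
  apply ext_entries <;> simp only [mul_apply] <;> simp [a, c]

theorem b_mul_a_mul_u_mul_c_mul_u : b * (a * u * c * u) = a * u * c * u * b := by
  have hre : (4 : O15).re = 4 := rfl
  have him : (4 : O15).im = 0 := rfl
  apply ext_entries <;> simp only [mul_apply] <;> ext <;> simp [a, b, u, c, hre, him]

theorem isResolvingTuple : IsResolvingTuple (proj a) (proj b) (proj u) (proj c) where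
  orderOf_a := orderOf_proj_a
  orderOf_b := orderOf_proj_b
  not_isOfFinOrder := proj_a_mul_proj_b ▸ not_isOfFinOrder_proj_t
  comm_u := by rw [proj_a_mul_proj_b, ← map_mul, ← map_mul, t_mul_u]
  comm_c := by rw [← map_mul, ← map_mul, a_mul_c]
  comm_w := by simp only [← map_mul, b_mul_a_mul_u_mul_c_mul_u]
  closure_eq := closure_proj_eq_top
  separating_c := exists_separating_c
  separating_u := exists_separating_u
  separating_ab := by
    obtain ⟨Φ, Ψ, h₁, h₂, h₃⟩ := exists_separating_of_hom _ proj_ofInt_eq_one_iff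
    rw [MonoidHom.comp_apply, ofInt_S] at h₁
    rw [MonoidHom.comp_apply, ofInt_S_mul_T] at h₂
    exact ⟨Φ, Ψ, h₁, h₂, h₃⟩
  separating_ab' := by
    obtain ⟨Φ, Ψ, h₁, h₂, h₃⟩ := exists_separating_of_hom _ proj_modularEmbedding_eq_one_iff
    rw [MonoidHom.comp_apply, modularEmbedding_S, proj_neg] at h₁
    rw [MonoidHom.comp_apply, modularEmbedding_S_mul_T, b'_eq, map_mul, map_mul, map_inv,
      map_mul] at h₂
    exact ⟨Φ, Ψ, h₁, h₂, h₃⟩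

end SL2O

theorem MulEquiv.apply_mem_closure_pair_iff {G H : Type} [Group G] [Group H] (e : G ≃* H)
    (g x y : G) : e g ∈ Subgroup.closure {e x, e y} ↔ g ∈ Subgroup.closure {x, y} := by
  rw [← Subgroup.mem_map_iff_mem (f := e.toMonoidHom) e.injective, MonoidHom.map_closure,
    Set.image_pair]
  rfl

theorem MulEquiv.apply_mem_zpowers_iff {G H : Type} [Group G] [Group H] (e : G ≃* H) (g x : G) :
    e g ∈ Subgroup.zpowers (e x) ↔ g ∈ Subgroup.zpowers x := by
  rw [← Subgroup.mem_map_iff_mem (f := e.toMonoidHom) e.injective, MonoidHom.map_zpowers]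
  rfl

open Classical in
theorem IsResolvingTuple.map {G H : Type} [Group G] [Group H] {a b u c : G}
    (h : IsResolvingTuple a b u c) (e : G ≃* H) : IsResolvingTuple (e a) (e b) (e u) (e c) where
  orderOf_a := by rw [MulEquiv.orderOf_eq, h.orderOf_a]
  orderOf_b := by rw [MulEquiv.orderOf_eq, h.orderOf_b]
  not_isOfFinOrder := by
    rw [← map_mul, ← orderOf_eq_zero_iff, MulEquiv.orderOf_eq, orderOf_eq_zero_iff]
    exact h.not_isOfFinOrder
  comm_u := by simp only [← map_mul, h.comm_u]
  comm_c := by simp only [← map_mul, h.comm_c]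
  comm_w := by simp only [← map_mul, h.comm_w]
  closure_eq := by
    have := e.toMonoidHom.map_closure {a, b, u, c}
    rw [h.closure_eq, Subgroup.map_top_of_surjective _ e.surjective] at this
    simpa [Set.image_insert_eq] using this.symm
  separating_c := by
    obtain ⟨Φ, ha, hb, hu, hc⟩ := h.separating_c
    refine ⟨Φ ∘ e.symm, ?_, ?_, ?_, e.surjective.forall.2 fun g => ?_⟩
    iterate 3
      simp only [e.surjective.forall, Function.comp_apply, ← map_mul,
        MulEquiv.symm_apply_apply, ha, hb, hu, implies_true]
    have hm := e.apply_mem_closure_pair_iff g a ((a * u)⁻¹ * b * (a * u))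
    simp only [map_mul, map_inv] at hm
    rw [Function.comp_apply, ← map_mul, Function.comp_apply, e.symm_apply_apply,
      e.symm_apply_apply, hc]
    exact if_congr hm.symm rfl rfl
  separating_u := by
    obtain ⟨Φ, ha, hb, hu⟩ := h.separating_u
    refine ⟨Φ ∘ e.symm, ?_, ?_, ?_⟩ <;>
      simp only [e.surjective.forall, Function.comp_apply, ← map_mul,
        MulEquiv.symm_apply_apply, MulEquiv.apply_mem_zpowers_iff, ha, hb, hu, implies_true]
  separating_ab := by
    obtain ⟨Φ, Ψ, ha, hb, hab⟩ := h.separating_ab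
    refine ⟨Φ ∘ e.symm, Ψ ∘ e.symm, ?_, ?_, fun g => ?_⟩
    iterate 2
      simp only [e.surjective.forall, Function.comp_apply, ← map_mul,
        MulEquiv.symm_apply_apply, ha, hb, implies_true]
    rw [Function.comp_apply, Function.comp_apply, hab]
    exact if_congr EmbeddingLike.map_eq_one_iff rfl rfl
  separating_ab' := by
    obtain ⟨Φ, Ψ, ha, hb, hab⟩ := h.separating_ab'
    refine ⟨Φ ∘ e.symm, Ψ ∘ e.symm, ?_, ?_, fun g => ?_⟩
    iterate 2
      simp only [e.surjective.forall, Function.comp_apply, ← map_mul, ← map_inv,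
        MulEquiv.symm_apply_apply, ha, hb, implies_true]
    rw [Function.comp_apply, Function.comp_apply, hab]
    exact if_congr EmbeddingLike.map_eq_one_iff rfl rfl

/-- An isomorphism of rings induces an isomorphism of special linear groups. -/
def slCongr {R S : Type} [CommRing R] [CommRing S] (e : R ≃+* S) :
    Matrix.SpecialLinearGroup (Fin 2) R ≃* Matrix.SpecialLinearGroup (Fin 2) S :=
  MonoidHom.toMulEquiv (Matrix.SpecialLinearGroup.map e.toRingHom)
    (Matrix.SpecialLinearGroup.map e.symm.toRingHom)
    (by ext; simp) (by ext; simp)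

theorem MulEquiv.map_center {G H : Type} [Group G] [Group H] (e : G ≃* H) :
    (Subgroup.center G).map e.toMonoidHom = Subgroup.center H := by
  ext x
  obtain ⟨g, rfl⟩ := e.surjective x
  rw [show e g = e.toMonoidHom g from rfl, Subgroup.mem_map_iff_mem e.injective,
    Subgroup.mem_center_iff, Subgroup.mem_center_iff, e.surjective.forall]
  refine forall_congr' fun y => ?_
  change _ ↔ e y * e g = e g * e y
  rw [← map_mul, ← map_mul, e.apply_eq_iff_eq]

/-- An isomorphism of rings induces an isomorphism of projective special linear groups. -/
def psl2Congr {R S : Type} [CommRing R] [CommRing S] (e : R ≃+* S) : PSL2 R ≃* PSL2 S :=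
  QuotientGroup.congr _ _ (slCongr e) (slCongr e).map_center

section RingOfIntegers

open QuadraticAlgebra

theorem Rat.exists_int_of_quadratic {x y : ℚ} {T n : ℤ} (hT : 2 * x + y = T)
    (hn : x ^ 2 + x * y + 4 * y ^ 2 = n) : ∃ i j : ℤ, x = i ∧ y = j := by
  have hsq : (15 * y) ^ 2 = ((15 * (4 * n - T ^ 2) : ℤ) : ℚ) := by
    push_cast
    rw [← hT, ← hn]
    ring
  have hintegral : IsIntegral ℤ (15 * y) := by
    refine IsIntegral.of_pow (n := 2) (by norm_num) ?_
    rw [hsq]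
    exact isIntegral_algebraMap
  obtain ⟨k, hk⟩ := IsIntegrallyClosed.isIntegral_iff.1 hintegral
  rw [eq_intCast] at hk
  rw [← hk] at hsq
  norm_cast at hsq
  have h₃ : (3 : ℤ) ∣ k := Int.prime_three.dvd_of_dvd_pow ⟨5 * (4 * n - T ^ 2), by rw [hsq]; ring⟩
  have h₅ : (5 : ℤ) ∣ k := (Int.prime_iff_natAbs_prime.2 (by norm_num)).dvd_of_dvd_pow
    ⟨3 * (4 * n - T ^ 2), by rw [hsq]; ring⟩
  obtain ⟨j, rfl⟩ : (15 : ℤ) ∣ k := by omega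
  have hy : y = j := by
    push_cast at hk
    linarith
  have hpar : 15 * j ^ 2 = 4 * n - T ^ 2 := by linarith
  obtain ⟨i, hi⟩ : (2 : ℤ) ∣ T - j := by
    have h₀ : T ^ 2 + 15 * j ^ 2 = 4 * n := by linarith
    have h₁ : (2 : ℤ) ∣ (T - j) ^ 2 := ⟨2 * n - 7 * j ^ 2 - T * j, by linarith⟩
    exact Int.prime_two.dvd_of_dvd_pow h₁
  refine ⟨i, j, ?_, hy⟩
  have : (T : ℚ) - j = 2 * i := by exact_mod_cast hi
  linarith

/-- The integral elements of the rational quadratic algebra have integral coordinates. -/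
theorem exists_int_of_isIntegral {z : QuadraticAlgebra ℚ (-4) 1} (hz : IsIntegral ℤ z) :
    ∃ i j : ℤ, z.re = i ∧ z.im = j := by
  have hs : IsIntegral ℤ (star z) :=
    hz.map (starRingEnd (QuadraticAlgebra ℚ (-4) 1)).toIntAlgHom
  have hinj : Function.Injective (algebraMap ℚ (QuadraticAlgebra ℚ (-4) 1)) :=
    fun x y h => by simpa using congrArg QuadraticAlgebra.re h
  have hlift : ∀ r : ℚ, IsIntegral ℤ (algebraMap ℚ (QuadraticAlgebra ℚ (-4) 1) r) →
      ∃ n : ℤ, (n : ℚ) = r := fun r hr => by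
    simpa using IsIntegrallyClosed.isIntegral_iff.1 ((isIntegral_algebraMap_iff hinj).1 hr)
  have hadd : z + star z = algebraMap ℚ _ (2 * z.re + z.im) := by
    ext <;> simp
    ring
  have hmul : z * star z = algebraMap ℚ _ (z.re ^ 2 + z.re * z.im + 4 * z.im ^ 2) := by
    rw [← algebraMap_norm_eq_mul_star, norm_def]
    congr 1
    ring
  obtain ⟨T, hT⟩ := hlift _ (hadd ▸ hz.add hs)
  obtain ⟨n, hn⟩ := hlift _ (hmul ▸ hz.mul hs)
  exact Rat.exists_int_of_quadratic hT.symm hn.symm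

theorem QuadraticAlgebra.lift_injective {R A : Type} [CommRing R] [LinearOrder R]
    [IsStrictOrderedRing R] [CommRing A] [Algebra R A] [FaithfulSMul R A]
    (f : QuadraticAlgebra R (-4) 1 →ₐ[R] A) : Function.Injective f := by
  rw [injective_iff_map_eq_zero]
  intro z hz
  have h : algebraMap R A (z.re ^ 2 + z.re * z.im + 4 * z.im ^ 2) = 0 := by
    rw [show z.re ^ 2 + z.re * z.im + 4 * z.im ^ 2 = z.norm by rw [norm_def]; ring,
      ← f.commutes, algebraMap_norm_eq_mul_star, map_mul, hz, zero_mul]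
  rw [map_eq_zero_iff _ (FaithfulSMul.algebraMap_injective R A)] at h
  have him : z.im = 0 := by
    refine pow_eq_zero_iff (two_ne_zero) |>.1 (le_antisymm ?_ (sq_nonneg _))
    nlinarith [sq_nonneg (2 * z.re + z.im), sq_nonneg z.im]
  have hre : z.re = 0 := by
    refine pow_eq_zero_iff (two_ne_zero) |>.1 ?_
    simpa [him] using h
  exact QuadraticAlgebra.ext hre him

/-- The ring of integers of `ℚ(√-15)` is `O15`. -/
theorem nonempty_ringOfIntegers_equiv (K : Type) [Field K] [NumberField K]
    (hdeg : Module.finrank ℚ K = 2) (hK : ∃ α : K, α ^ 2 = -15) :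
    Nonempty (O15 ≃+* NumberField.RingOfIntegers K) := by
  obtain ⟨α, hα⟩ := hK
  obtain ⟨w, hw⟩ : ∃ w : K, w * w = w - 4 := ⟨(1 + α) / 2, by linear_combination hα / 4⟩
  have hintegral : IsIntegral ℤ w := by
    refine ⟨Polynomial.X ^ 2 - Polynomial.X + Polynomial.C 4, by monicity!, ?_⟩
    simp
    linear_combination hw
  obtain ⟨v, rfl⟩ : ∃ v : NumberField.RingOfIntegers K, (v : K) = w := ⟨⟨w, hintegral⟩, rfl⟩
  have hv : v * v = v - 4 := by
    apply NumberField.RingOfIntegers.coe_injective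
    rw [map_mul, map_sub, map_ofNat, hw]
  let f : O15 →ₐ[ℤ] NumberField.RingOfIntegers K := QuadraticAlgebra.lift ⟨v, by
    simp
    linear_combination hv⟩
  let F : QuadraticAlgebra ℚ (-4) 1 →ₐ[ℚ] K := QuadraticAlgebra.lift ⟨v, by
    simp [Algebra.smul_def]
    linear_combination hw⟩
  have hF := QuadraticAlgebra.lift_injective F
  have hsurj : Function.Surjective F :=
    (LinearMap.injective_iff_surjective_of_finrank_eq_finrank (f := F.toLinearMap)
      (by rw [QuadraticAlgebra.finrank_eq_two, hdeg])).1 hF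
  refine ⟨RingEquiv.ofBijective f ⟨QuadraticAlgebra.lift_injective f, fun x => ?_⟩⟩
  obtain ⟨z, hz⟩ := hsurj x
  have hzint : IsIntegral ℤ z := by
    refine (isIntegral_algHom_iff (F.restrictScalars ℤ) hF).1 ?_
    change IsIntegral ℤ (F z)
    rw [hz]
    exact x.isIntegral_coe
  obtain ⟨i, j, hi, hj⟩ := exists_int_of_isIntegral hzint
  refine ⟨⟨i, j⟩, NumberField.RingOfIntegers.ext ?_⟩
  rw [← hz]
  simp [f, F, hi, hj, Algebra.smul_def]

end RingOfIntegers

/-- The integral homology of `PSL₂(𝒪₋₁₅)`, where `𝒪₋₁₅` is the ring of integers of `ℚ(√-15)`. -/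
theorem homology_PSL2_O15 (K : Type) [Field K] [NumberField K]
    (hdeg : Module.finrank ℚ K = 2) (hK : ∃ α : K, α ^ 2 = -15)
    (q : ℕ) (hq : 1 ≤ q) :
    (q = 1 → Nonempty (GroupHomology ℤ (PSL2 (NumberField.RingOfIntegers K)) ℤ q ≃+
      ((Fin 2 → ℤ) × ZMod 3 × ZMod 2))) ∧
    (q = 2 → Nonempty (GroupHomology ℤ (PSL2 (NumberField.RingOfIntegers K)) ℤ q ≃+
      (ℤ × ZMod 3 × ZMod 2))) ∧
    (3 ≤ q → Nonempty (GroupHomology ℤ (PSL2 (NumberField.RingOfIntegers K)) ℤ q ≃+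
      (ZMod 3 × ZMod 2))) := by
  obtain ⟨e⟩ := nonempty_ringOfIntegers_equiv K hdeg hK
  exact (SL2O.isResolvingTuple.map (psl2Congr e)).homology q hq
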